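/- For every ε > 0 and δ > 0 there exists N such that for all n ≥ N and all integers ℓ ≥ (1+ε)n, the proportion of ℓ-lifts of K_n that contain a topological clique of order n (i.e. a subdivision of K_n) as a subgraph is at least 1 − δ. -/

import Mathlib

/-- The `ℓ`-lift of the complete graph `K_n` determined by a family of permutations
`σ` (only the values `σ i j` for `i < j` matter): vertices `(i,a)` and `(j, σ i j a)`
are adjacent for `i < j`. -/
def liftGraph (n ℓ : ℕ) (σ : Fin n → Fin n → Equiv.Perm (Fin ℓ)) :
    SimpleGraph (Fin n × Fin ℓ) :=
  SimpleGraph.fromRel (fun x y => x.1 < y.1 ∧ σ x.1 y.1 x.2 = y.2)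

/-- The proportion of `ℓ`-lifts of `K_n` (all chosen uniformly at random) whose lift
graph satisfies the property `p`. -/
noncomputable def liftProb (n ℓ : ℕ) (p : SimpleGraph (Fin n × Fin ℓ) → Prop) : ℝ :=
  ((@Finset.filter _ (fun σ : Fin n → Fin n → Equiv.Perm (Fin ℓ) => p (liftGraph n ℓ σ))
      (Classical.decPred _) Finset.univ).card : ℝ)
    / (Fintype.card (Fin n → Fin n → Equiv.Perm (Fin ℓ)) : ℝ)

/-- `f : Fin m → V` is the family of branch vertices of a topological clique of order `m`
in `G`: `f` is injective and there are pairwise internally vertex-disjoint paths between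
the branch vertices whose internal vertices avoid all branch vertices. -/
def HasTopCliqueFun {V : Type*} (G : SimpleGraph V) {m : ℕ} (f : Fin m → V) : Prop :=
  Function.Injective f ∧
  ∃ P : ∀ i j : Fin m, G.Walk (f i) (f j),
    (∀ i j : Fin m, i < j → (P i j).IsPath) ∧
    (∀ i j : Fin m, i < j → ∀ k : Fin m, f k ∉ (P i j).support.tail.dropLast) ∧
    (∀ i j i' j' : Fin m, i < j → i' < j' → (i, j) ≠ (i', j') →
      ∀ x, x ∈ (P i j).support.tail.dropLast → x ∉ (P i' j').support.tail.dropLast)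

/-- `G` contains a topological clique of order `m` (a subdivision of `K_m`). -/
def HasTopClique {V : Type*} (G : SimpleGraph V) (m : ℕ) : Prop :=
  ∃ f : Fin m → V, HasTopCliqueFun G f

section Linking

variable {V : Type*} [Fintype V] (G : SimpleGraph V)

open Classical in
/-- The set of vertices with a neighbour in `U`. -/
noncomputable def nbrs (U : Finset V) : Finset V :=
  Finset.univ.filter (fun v => ∃ u ∈ U, G.Adj u v)

/-- Any two sets of at least `m` vertices are joined by an edge. -/
def IsJoined (m : ℕ) : Prop :=
  ∀ A B : Finset V, m ≤ A.card → m ≤ B.card → ∃ a ∈ A, ∃ b ∈ B, G.Adj a b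

variable {G}

lemma mem_nbrs {U : Finset V} {v : V} : v ∈ nbrs G U ↔ ∃ u ∈ U, G.Adj u v := by
  simp [nbrs]

lemma nbrs_mono {U U' : Finset V} (h : U ⊆ U') : nbrs G U ⊆ nbrs G U' := by
  intro v hv
  rw [mem_nbrs] at *
  obtain ⟨u, hu, ha⟩ := hv
  exact ⟨u, h hu, ha⟩

variable [DecidableEq V]

variable (G) in
/-- Every set `U` of at most `2 * m` vertices has, outside `W`, at least as many neighbours as
the total demand `c` of its elements. -/
def MeetsDemand (m : ℕ) (W : Finset V) (c : V → ℤ) : Prop :=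
  ∀ U : Finset V, U.card ≤ 2 * m → ∑ u ∈ U, c u ≤ ((nbrs G U \ W).card : ℤ)

lemma nbrs_union (U U' : Finset V) : nbrs G (U ∪ U') = nbrs G U ∪ nbrs G U' := by
  ext v
  simp only [mem_nbrs, Finset.mem_union]
  grind

lemma IsJoined.card_lt_card_nbrs {m : ℕ} (hj : IsJoined G m) {U : Finset V} (hU : m ≤ U.card) :
    Fintype.card V < (nbrs G U).card + m := by
  by_contra! h
  have h1 : m ≤ ((nbrs G U)ᶜ).card := by
    rw [Finset.card_compl]; omega
  obtain ⟨a, ha, b, hb, hab⟩ := hj U _ hU h1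
  rw [Finset.mem_compl, mem_nbrs] at hb
  exact hb ⟨a, ha, hab⟩

lemma MeetsDemand.critical_union {m : ℕ} {W : Finset V} {c : V → ℤ} (hE : MeetsDemand G m W c)
    {U₁ U₂ : Finset V} (h₁ : U₁.card ≤ m)
    (e₁ : ((nbrs G U₁ \ W).card : ℤ) ≤ ∑ u ∈ U₁, c u)
    (e₂ : ((nbrs G U₂ \ W).card : ℤ) ≤ ∑ u ∈ U₂, c u) :
    ((nbrs G (U₁ ∪ U₂) \ W).card : ℤ) ≤ ∑ u ∈ U₁ ∪ U₂, c u := by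
  have hi := hE (U₁ ∩ U₂) (by
    have := Finset.card_le_card (Finset.inter_subset_left (s₁ := U₁) (s₂ := U₂)); omega)
  have hs := Finset.sum_union_inter (s₁ := U₁) (s₂ := U₂) (f := c)
  have h3 := Finset.card_union_add_card_inter (nbrs G U₁ \ W) (nbrs G U₂ \ W)
  have h4 : nbrs G (U₁ ∪ U₂) \ W = (nbrs G U₁ \ W) ∪ (nbrs G U₂ \ W) := by
    rw [nbrs_union, Finset.union_sdiff_distrib]
  have h5 : nbrs G (U₁ ∩ U₂) \ W ⊆ (nbrs G U₁ \ W) ∩ (nbrs G U₂ \ W) := by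
    intro v hv
    rw [Finset.mem_sdiff] at hv
    simp only [Finset.mem_inter, Finset.mem_sdiff]
    exact ⟨⟨nbrs_mono Finset.inter_subset_left hv.1, hv.2⟩,
      ⟨nbrs_mono Finset.inter_subset_right hv.1, hv.2⟩⟩
  have h6 := Finset.card_le_card h5
  rw [h4]
  zify at h3 h6
  linarith

/-- A vertex with positive demand can be served by one of its neighbours outside `W`. -/
lemma MeetsDemand.exists_serve {m : ℕ} {W : Finset V} {c : V → ℤ} (hE : MeetsDemand G m W c)
    (hc : ∀ v, c v ≤ 2) (hj : IsJoined G m) (hm : 1 ≤ m) {s : V} (hs : 1 ≤ c s)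
    (hW : W.card + 5 * m ≤ Fintype.card V) :
    ∃ y, G.Adj s y ∧ y ∉ W ∧
      MeetsDemand G m (insert y W) (fun v => c v - if v = s then 1 else 0) := by
  by_contra! hno
  have small : ∀ U : Finset V, U.card ≤ 2 * m →
      ((nbrs G U \ W).card : ℤ) ≤ ∑ u ∈ U, c u → U.card < m := by
    intro U hU hcr
    by_contra! hge
    have h1 := hj.card_lt_card_nbrs hge
    have h2 : ∑ u ∈ U, c u ≤ 2 * (U.card : ℤ) := by
      calc ∑ u ∈ U, c u ≤ ∑ _u ∈ U, (2 : ℤ) := Finset.sum_le_sum fun u _ => hc u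
        _ = 2 * (U.card : ℤ) := by simp [mul_comm]
    have h3 := Finset.le_card_sdiff W (nbrs G U)
    omega
  have claim : ∀ y, G.Adj s y → y ∉ W → ∃ U : Finset V, U.card ≤ 2 * m ∧ s ∉ U ∧
      y ∈ nbrs G U ∧ ((nbrs G U \ W).card : ℤ) ≤ ∑ u ∈ U, c u := by
    intro y hy hyW
    have := hno y hy hyW
    unfold MeetsDemand at this
    push Not at this
    obtain ⟨U, hU, hlt⟩ := this
    have h0 := hE U hU
    rw [Finset.sum_sub_distrib, Finset.sum_ite_eq' U s (fun _ => (1 : ℤ))] at hlt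
    have hsub : (nbrs G U \ W) ⊆ insert y (nbrs G U \ insert y W) := by
      intro v; simp only [Finset.mem_sdiff, Finset.mem_insert]; tauto
    have h1 := (Finset.card_le_card hsub).trans (Finset.card_insert_le _ _)
    have hsU : s ∉ U := by
      intro h
      rw [if_pos h] at hlt
      omega
    rw [if_neg hsU] at hlt
    refine ⟨U, hU, hsU, ?_, by omega⟩
    by_contra hyU
    have : nbrs G U \ insert y W = nbrs G U \ W := by
      ext v; simp only [Finset.mem_sdiff, Finset.mem_insert]
      constructor
      · tauto
      · rintro ⟨h1, h2⟩
        exact ⟨h1, fun h => h.elim (fun h => hyU (h ▸ h1)) h2⟩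
    rw [this] at hlt
    omega
  have claim2 : ∀ Y : Finset V, (∀ y ∈ Y, G.Adj s y ∧ y ∉ W) → ∃ U : Finset V, U.card ≤ 2 * m ∧
      s ∉ U ∧ Y ⊆ nbrs G U ∧ ((nbrs G U \ W).card : ℤ) ≤ ∑ u ∈ U, c u := by
    intro Y
    induction Y using Finset.induction_on with
    | empty =>
      intro _
      refine ⟨∅, by simp, by simp, by simp, ?_⟩
      have : nbrs G (∅ : Finset V) = ∅ := by ext v; simp [mem_nbrs]
      simp [this]
    | insert y Y _ ih =>
      intro hY
      obtain ⟨U₁, h1, h2, h3, h4⟩ := ih fun z hz => hY z (Finset.mem_insert_of_mem hz)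
      obtain ⟨hy, hyW⟩ := hY y (Finset.mem_insert_self _ _)
      obtain ⟨U₂, g1, g2, g3, g4⟩ := claim y hy hyW
      have s1 := small U₁ h1 h4
      have s2 := small U₂ g1 g4
      refine ⟨U₁ ∪ U₂, ?_, by simp [h2, g2], ?_, hE.critical_union s1.le h4 g4⟩
      · have := Finset.card_union_le U₁ U₂; omega
      · rw [nbrs_union]
        intro z hz
        rcases Finset.mem_insert.1 hz with rfl | hz
        · exact Finset.mem_union_right _ g3
        · exact Finset.mem_union_left _ (h3 hz)
  classical
  obtain ⟨U, h1, h2, h3, h4⟩ := claim2 (Finset.univ.filter fun y => G.Adj s y ∧ y ∉ W)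
    (by simp)
  have hsm := small U h1 h4
  have h5 := hE (insert s U) (by have := Finset.card_insert_le s U; omega)
  rw [Finset.sum_insert h2] at h5
  have h6 : nbrs G (insert s U) \ W ⊆ nbrs G U \ W := by
    intro v hv
    simp only [Finset.mem_sdiff, mem_nbrs, Finset.mem_insert] at hv ⊢
    refine ⟨?_, hv.2⟩
    obtain ⟨⟨u, rfl | hu, ha⟩, hv⟩ := hv
    · exact mem_nbrs.1 (h3 (by simp [ha, hv]))
    · exact ⟨u, hu, ha⟩
  have h7 := Finset.card_le_card h6
  omega

/-- Vertices that have been added to serve a demand may be given back. -/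
lemma MeetsDemand.prune {m : ℕ} {W A Q : Finset V} {c : V → ℤ} {par : V → V}
    (hE : MeetsDemand G m (W ∪ A) (fun v => c v - ((A.filter fun y => par y = v).card : ℤ)))
    (hd : Disjoint A W) (hpar : ∀ y ∈ A, G.Adj (par y) y) (hQ : Q ⊆ A) :
    MeetsDemand G m (W ∪ Q) (fun v => c v - ((Q.filter fun y => par y = v).card : ℤ)) := by
  intro U hU
  have h0 := hE U hU
  rw [Finset.sum_sub_distrib] at h0 ⊢
  have key : ∀ B : Finset V, (∑ u ∈ U, ((B.filter fun y => par y = u).card : ℤ))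
      = ((B.filter fun y => par y ∈ U).card : ℤ) := by
    intro B
    rw [Finset.card_eq_sum_card_fiberwise (f := par) (s := B.filter fun y => par y ∈ U) (t := U)]
    · push_cast
      refine Finset.sum_congr rfl fun u hu => ?_
      congr 2
      ext y
      simp only [Finset.mem_filter]
      constructor
      · rintro ⟨h, rfl⟩; exact ⟨⟨h, hu⟩, rfl⟩
      · rintro ⟨⟨h, _⟩, h'⟩; exact ⟨h, h'⟩
    · intro y hy
      exact (Finset.mem_filter.1 hy).2
  rw [key] at h0 ⊢
  have h1 : (A.filter fun y => par y ∈ U).card =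
      (Q.filter fun y => par y ∈ U).card + ((A \ Q).filter fun y => par y ∈ U).card := by
    rw [← Finset.card_union_of_disjoint, ← Finset.filter_union, Finset.union_sdiff_of_subset hQ]
    exact Finset.disjoint_filter_filter Finset.disjoint_sdiff
  have h2 : (nbrs G U \ (W ∪ A)) ∪ ((A \ Q).filter fun y => par y ∈ U) ⊆ nbrs G U \ (W ∪ Q) := by
    intro v hv
    simp only [Finset.mem_union, Finset.mem_sdiff, Finset.mem_filter, mem_nbrs] at hv ⊢
    rcases hv with ⟨h, h'⟩ | ⟨⟨h, h'⟩, h''⟩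
    · exact ⟨h, fun hh => h' (hh.imp id fun x => hQ x)⟩
    · refine ⟨⟨par v, h'', hpar v h⟩, ?_⟩
      rintro (hh | hh)
      · exact Finset.disjoint_left.1 hd h hh
      · exact h' hh
  have h3 := Finset.card_le_card h2
  rw [Finset.card_union_of_disjoint] at h3
  · zify at h1 h3
    linarith
  · rw [Finset.disjoint_left]
    intro v hv hv'
    simp only [Finset.mem_union, Finset.mem_sdiff, Finset.mem_filter] at hv hv'
    exact hv.2 (Or.inr hv'.1.1)

lemma MeetsDemand.mono {m : ℕ} {W P : Finset V} {c c' : V → ℤ} (hE : MeetsDemand G m W c)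
    (h1 : ∀ v ∈ P, c' v ≤ c v) (h2 : ∀ v ∉ P, c' v ≤ 0) : MeetsDemand G m W c' := by
  intro U hU
  have h3 := hE (U ∩ P) ((Finset.card_le_card Finset.inter_subset_left).trans hU)
  have h4 : ((nbrs G (U ∩ P) \ W).card : ℤ) ≤ (nbrs G U \ W).card := by
    exact_mod_cast Finset.card_le_card
      (Finset.sdiff_subset_sdiff (nbrs_mono Finset.inter_subset_left) subset_rfl)
  calc ∑ u ∈ U, c' u ≤ ∑ u ∈ U ∩ P, c' u := by
        rw [← Finset.sum_inter_add_sum_sdiff U P]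
        have : ∑ u ∈ U \ P, c' u ≤ 0 :=
          Finset.sum_nonpos fun u hu => h2 u (Finset.mem_sdiff.1 hu).2
        linarith
    _ ≤ ∑ u ∈ U ∩ P, c u := Finset.sum_le_sum fun u hu => h1 u (Finset.mem_inter.1 hu).2
    _ ≤ _ := h3.trans h4

end Linking

section Trees

variable {V : Type*} [DecidableEq V] {G : SimpleGraph V}

/-- `A` is the set of non-root vertices of a tree of height at most `h` rooted at `x`,
with parent function `par` and depth function `dep`. -/
def IsTreeOn (G : SimpleGraph V) (x : V) (h : ℕ) (A : Finset V) (par : V → V) (dep : V → ℕ) :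
    Prop :=
  dep x = 0 ∧ ∀ v ∈ A, par v ∈ insert x A ∧ G.Adj (par v) v ∧ dep v = dep (par v) + 1 ∧ dep v ≤ h

lemma IsTreeOn.exists_walk {x : V} {h : ℕ} {A : Finset V} {par : V → V} {dep : V → ℕ}
    (ht : IsTreeOn G x h A par dep) (k : ℕ) : ∀ a ∈ insert x A, dep a = k →
    ∃ Q ⊆ A, Q.card ≤ k ∧ (∀ z ∈ Q, par z ∈ insert x Q) ∧ a ∈ insert x Q ∧
      ∃ w : G.Walk x a, ∀ v ∈ w.support, v ∈ insert x Q := by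
  induction k with
  | zero =>
    intro a ha hk
    rcases Finset.mem_insert.1 ha with rfl | ha
    · exact ⟨∅, by simp, by simp, by simp, by simp, .nil, by simp⟩
    · have := (ht.2 a ha).2.2.1
      omega
  | succ k ih =>
    intro a ha hk
    rcases Finset.mem_insert.1 ha with rfl | ha
    · have := ht.1
      omega
    · obtain ⟨h1, h2, h3, -⟩ := ht.2 a ha
      obtain ⟨Q, hQ, hc, hp, hm, w, hw⟩ := ih (par a) h1 (by omega)
      refine ⟨insert a Q, ?_, ?_, ?_, by simp, w.concat h2, ?_⟩
      · intro z hz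
        rcases Finset.mem_insert.1 hz with rfl | hz
        · exact ha
        · exact hQ hz
      · have := Finset.card_insert_le a Q
        omega
      · intro z hz
        rcases Finset.mem_insert.1 hz with rfl | hz
        · simp only [Finset.mem_insert] at hm ⊢; tauto
        · have := hp z hz
          simp only [Finset.mem_insert] at this ⊢; tauto
      · intro v hv
        rw [SimpleGraph.Walk.support_concat] at hv
        simp only [List.mem_append, List.mem_singleton] at hv
        rcases hv with hv | rfl
        · have := hw v hv
          simp only [Finset.mem_insert] at this ⊢; tauto
        · simp

/-- A tree in which every non-maximal-depth vertex has two children has many vertices. -/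
lemma IsTreeOn.two_pow_le {x : V} {h : ℕ} {A : Finset V} {par : V → V} {dep : V → ℕ}
    (ht : IsTreeOn G x h A par dep) (hxA : x ∉ A)
    (hfull : ∀ s ∈ insert x A, dep s < h → 2 ≤ (A.filter fun y => par y = s).card) :
    2 ^ h ≤ A.card + 1 := by
  have lev : ∀ i ≤ h, 2 ^ i ≤ ((insert x A).filter fun v => dep v = i).card := by
    intro i
    induction i with
    | zero =>
      intro _
      rw [pow_zero, Nat.one_le_iff_ne_zero, ← Nat.pos_iff_ne_zero, Finset.card_pos]
      exact ⟨x, by simp [ht.1]⟩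
    | succ i ih =>
      intro hi
      have h1 := ih (by omega)
      have h2 : ((insert x A).filter fun v => dep v = i).card * 2 ≤
          (((insert x A).filter fun v => dep v = i).biUnion
            fun s => A.filter fun y => par y = s).card := by
        rw [Finset.card_biUnion]
        · rw [← smul_eq_mul]
          refine Finset.card_nsmul_le_sum _ _ _ ?_
          intro s hs
          rw [Finset.mem_filter] at hs
          exact hfull s hs.1 (by omega)
        · intro s _ s' _ hne
          rw [Function.onFun, Finset.disjoint_left]
          intro y hy hy'
          rw [Finset.mem_filter] at hy hy'
          exact hne (hy.2.symm.trans hy'.2)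
      have h3 : (((insert x A).filter fun v => dep v = i).biUnion
            fun s => A.filter fun y => par y = s) ⊆
            (insert x A).filter fun v => dep v = i + 1 := by
        intro y hy
        simp only [Finset.mem_biUnion, Finset.mem_filter] at hy
        obtain ⟨s, ⟨_, hs⟩, hy, rfl⟩ := hy
        have := (ht.2 y hy).2.2.1
        simp only [Finset.mem_filter, Finset.mem_insert]
        exact ⟨Or.inr hy, by omega⟩
      have h4 := Finset.card_le_card h3
      rw [pow_succ]
      omega
  have h1 := lev h le_rfl
  have h2 := Finset.card_filter_le (insert x A) (fun v => dep v = h)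
  rw [Finset.card_insert_of_notMem hxA] at h2
  omega

lemma filter_par_eq_empty {Q : Finset V} {x v : V} {par : V → V}
    (hpar : ∀ z ∈ Q, par z ∈ insert x Q) (hv : v ∉ insert x Q) :
    (Q.filter fun z => par z = v) = ∅ := by
  rw [Finset.filter_eq_empty_iff]
  rintro z hz rfl
  exact hv (hpar z hz)

variable [Fintype V]

lemma MeetsDemand.exists_tree {m h : ℕ} {W : Finset V} {c : V → ℤ} (hE : MeetsDemand G m W c)
    (hc : ∀ v, c v ≤ 2) (hj : IsJoined G m) (hm : 1 ≤ m) {x : V} (hx : x ∈ W) (hcx : c x = 2)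
    (hout : ∀ v ∉ W, c v = 2) (hW : W.card + 6 * m ≤ Fintype.card V) (hh : m < 2 ^ h) :
    ∃ (A : Finset V) (par : V → V) (dep : V → ℕ), Disjoint A W ∧ A.card = m ∧
      IsTreeOn G x h A par dep ∧
      MeetsDemand G m (W ∪ A) (fun v => c v - ((A.filter fun y => par y = v).card : ℤ)) := by
  have main : ∀ j ≤ m, ∃ (A : Finset V) (par : V → V) (dep : V → ℕ), Disjoint A W ∧ A.card = j ∧
      IsTreeOn G x h A par dep ∧
      MeetsDemand G m (W ∪ A) (fun v => c v - ((A.filter fun y => par y = v).card : ℤ)) := by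
    intro j
    induction j with
    | zero =>
      intro _
      refine ⟨∅, id, fun _ => 0, by simp, by simp, ⟨rfl, by simp⟩, by simpa using hE⟩
    | succ j ih =>
      intro hjm
      obtain ⟨A, par, dep, hd, hA, ht, hS⟩ := ih (by omega)
      have hxA : x ∉ A := fun h => Finset.disjoint_left.1 hd h hx
      have hex : ∃ s ∈ insert x A, dep s < h ∧ (A.filter fun y => par y = s).card < 2 := by
        by_contra! hno
        have := ht.two_pow_le hxA hno
        omega
      obtain ⟨s, hs, hsh, hsc⟩ := hex
      have hcs : c s = 2 := by
        rcases Finset.mem_insert.1 hs with rfl | hs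
        · exact hcx
        · exact hout s (Finset.disjoint_left.1 hd hs)
      have hcard : (W ∪ A).card ≤ W.card + j := hA ▸ Finset.card_union_le W A
      obtain ⟨y, hy, hyW, hS'⟩ := hS.exists_serve (s := s)
        (fun v => by have := hc v; omega) hj hm (by simp only [hcs]; omega) (by omega)
      rw [Finset.mem_union, not_or] at hyW
      have hyx : y ≠ x := fun h => hyW.1 (h ▸ hx)
      have hne : ∀ z ∈ insert x A, z ≠ y := by
        rintro z hz rfl
        rcases Finset.mem_insert.1 hz with rfl | hz
        · exact hyx rfl
        · exact hyW.2 hz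
      refine ⟨insert y A, Function.update par y s, Function.update dep y (dep s + 1), ?_, ?_,
        ⟨?_, ?_⟩, ?_⟩
      · rw [Finset.disjoint_insert_left]; exact ⟨hyW.1, hd⟩
      · rw [Finset.card_insert_of_notMem hyW.2, hA]
      · rw [Function.update_of_ne hyx.symm, ht.1]
      · intro v hv
        rcases Finset.mem_insert.1 hv with rfl | hv
        · rw [Function.update_self, Function.update_self, Function.update_of_ne (hne s hs)]
          refine ⟨?_, hy, rfl, by omega⟩
          simp only [Finset.mem_insert] at hs ⊢; tauto
        · obtain ⟨h1, h2, h3, h4⟩ := ht.2 v hv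
          have hvy := hne v (Finset.mem_insert_of_mem hv)
          rw [Function.update_of_ne hvy, Function.update_of_ne hvy,
            Function.update_of_ne (hne _ h1)]
          refine ⟨?_, h2, h3, h4⟩
          simp only [Finset.mem_insert] at h1 ⊢; tauto
      · rw [Finset.union_insert]
        convert hS' using 2 with v
        rw [Finset.filter_insert, Function.update_self]
        have hf : (A.filter fun z => Function.update par y s z = v) =
            A.filter fun z => par z = v := by
          refine Finset.filter_congr fun z hz => ?_
          rw [Function.update_of_ne (hne z (Finset.mem_insert_of_mem hz))]
        rw [hf]
        by_cases hv : v = s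
        · rw [if_pos hv.symm, if_pos hv, Finset.card_insert_of_notMem (by simp [hyW.2])]
          push_cast; ring
        · rw [if_neg (Ne.symm hv), if_neg hv]; ring
  exact main m le_rfl

/-- The demand function equal to `2` on `P` and `0` elsewhere. -/
def twoOn (P : Finset V) : V → ℤ := fun v => if v ∈ P then 2 else 0

/-- Two active vertices can be connected by a short path so that the rest still expands. -/
lemma MeetsDemand.exists_connection {m h : ℕ} {W P : Finset V}
    (hE : MeetsDemand G m W (twoOn P)) (hj : IsJoined G m) (hm : 1 ≤ m)
    (hout : ∀ v ∉ W, v ∈ P) {x y : V} (hx : x ∈ W) (hxP : x ∈ P) (hy : y ∈ W) (hyP : y ∈ P)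
    (hxy : x ≠ y) (hW : W.card + 7 * m ≤ Fintype.card V) (hh : m < 2 ^ h) :
    ∃ Q : Finset V, Disjoint Q W ∧ Q.card ≤ 2 * h ∧
      (∃ w : G.Walk x y, ∀ v ∈ w.support, v = x ∨ v = y ∨ v ∈ Q) ∧
      MeetsDemand G m (W ∪ Q) (twoOn (P \ (insert x (insert y Q)))) := by
  obtain ⟨A, par, dep, hd, hA, ht, hS⟩ := hE.exists_tree
    (fun v => by unfold twoOn; split_ifs <;> norm_num) hj hm hx (by simp [twoOn, hxP])
    (fun v hv => by simp [twoOn, hout v hv]) (by omega) hh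
  have hyA : y ∉ insert x A := by
    rw [Finset.mem_insert, not_or]
    exact ⟨hxy.symm, fun h => Finset.disjoint_left.1 hd h hy⟩
  have hz : ∀ v ∉ insert x A, (A.filter fun z => par z = v).card = 0 := by
    intro v hv
    rw [filter_par_eq_empty (fun z hz => (ht.2 z hz).1) hv, Finset.card_empty]
  have hWA : (W ∪ A).card ≤ W.card + m := hA ▸ Finset.card_union_le W A
  obtain ⟨B, par', dep', hd', hB, ht', hS'⟩ := hS.exists_tree
    (fun v => by unfold twoOn; split_ifs <;> omega) hj hm
    (Finset.mem_union_left _ hy) (by simp only [hz y hyA]; simp [twoOn, hyP])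
    (fun v hv => by
      rw [Finset.mem_union, not_or] at hv
      have : v ∉ insert x A := by
        rw [Finset.mem_insert, not_or]
        exact ⟨fun h => hv.1 (h ▸ hx), hv.2⟩
      simp only [hz v this]
      simp [twoOn, hout v hv.1]) (by omega) hh
  obtain ⟨a, ha, b, hb, hab⟩ := hj A B hA.ge hB.ge
  obtain ⟨Q, hQ, hQc, hQp, -, w, hw⟩ :=
    ht.exists_walk _ a (Finset.mem_insert_of_mem ha) rfl
  obtain ⟨R, hR, hRc, hRp, -, w', hw'⟩ :=
    ht'.exists_walk _ b (Finset.mem_insert_of_mem hb) rfl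
  have hda := (ht.2 a ha).2.2.2
  have hdb := (ht'.2 b hb).2.2.2
  have hBW : Disjoint B W := hd'.mono_right Finset.subset_union_left
  have hBA : Disjoint B A := hd'.mono_right Finset.subset_union_right
  have p1 := hS'.prune hd' (fun z hz => (ht'.2 z hz).2.1) hR
  have p2 : MeetsDemand G m ((W ∪ R) ∪ A) (fun v =>
      (twoOn P v - ((R.filter fun z => par' z = v).card : ℤ)) -
        ((A.filter fun z => par z = v).card : ℤ)) := by
    rw [Finset.union_right_comm]
    convert p1 using 2
    ring
  have p3 := p2.prune (Finset.disjoint_union_right.2 ⟨hd, (hBA.mono_left hR).symm⟩)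
    (fun z hz => (ht.2 z hz).2.1) hQ
  refine ⟨Q ∪ R, ?_, ?_, ⟨(w.concat hab).append w'.reverse, ?_⟩, ?_⟩
  · exact Finset.disjoint_union_left.2 ⟨hd.mono_left hQ, hBW.mono_left hR⟩
  · have := Finset.card_union_le Q R
    omega
  · intro v hv
    rw [SimpleGraph.Walk.mem_support_append_iff, SimpleGraph.Walk.support_concat,
      SimpleGraph.Walk.support_reverse, List.mem_reverse] at hv
    simp only [List.mem_append, List.mem_singleton] at hv
    rw [Finset.mem_union]
    rcases hv with (hv | rfl) | hv
    · have := hw v hv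
      rw [Finset.mem_insert] at this; tauto
    · have := hw' v w'.end_mem_support
      rw [Finset.mem_insert] at this; tauto
    · have := hw' v hv
      rw [Finset.mem_insert] at this; tauto
  · have he : W ∪ (Q ∪ R) = W ∪ R ∪ Q := by
      rw [Finset.union_comm Q R, Finset.union_assoc]
    rw [he]
    refine p3.mono (P := P \ (insert x (insert y (Q ∪ R)))) ?_ ?_
    · intro v hv
      simp only [Finset.mem_sdiff, Finset.mem_insert, Finset.mem_union, not_or] at hv
      obtain ⟨hvP, hvx, hvy, hvQ, hvR⟩ := hv
      rw [filter_par_eq_empty hQp (by simp [hvx, hvQ]),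
        filter_par_eq_empty hRp (by simp [hvy, hvR])]
      simp [twoOn, hvP, hvx, hvy, hvQ, hvR]
    · intro v hv
      rw [twoOn, if_neg hv]

/-- All the given pairs of active vertices can be linked by internally disjoint paths. -/
lemma MeetsDemand.exists_linking {ι : Type*} {m h : ℕ} (hj : IsJoined G m) (hm : 1 ≤ m)
    (hh : m < 2 ^ h) (x y : ι → V) (E : Finset ι) : ∀ W P : Finset V,
    MeetsDemand G m W (twoOn P) → (∀ v ∉ W, v ∈ P) →
    (∀ e ∈ E, x e ∈ W ∧ x e ∈ P ∧ y e ∈ W ∧ y e ∈ P ∧ x e ≠ y e) →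
    (∀ e ∈ E, ∀ e' ∈ E, e ≠ e' → x e ≠ x e' ∧ x e ≠ y e' ∧ y e ≠ x e' ∧ y e ≠ y e') →
    W.card + 7 * m + 2 * h * E.card ≤ Fintype.card V →
    ∃ Q : ι → Finset V, (∀ e ∈ E, Disjoint (Q e) W ∧
      ∃ w : G.Walk (x e) (y e), ∀ v ∈ w.support, v = x e ∨ v = y e ∨ v ∈ Q e) ∧
      ∀ e ∈ E, ∀ e' ∈ E, e ≠ e' → Disjoint (Q e) (Q e') := by
  classical
  induction E using Finset.induction_on with
  | empty => intro W P _ _ _ _ _; exact ⟨fun _ => ∅, by simp, by simp⟩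
  | insert e E he ih =>
    intro W P hE hout hmem hdis hcard
    rw [Finset.card_insert_of_notMem he] at hcard
    obtain ⟨h1, h2, h3, h4, h5⟩ := hmem e (Finset.mem_insert_self _ _)
    obtain ⟨Q, hQW, hQc, hw, hS⟩ := hE.exists_connection hj hm hout h1 h2 h3 h4 h5
      (by nlinarith) hh
    have hc := Finset.card_union_le W Q
    obtain ⟨R, hR1, hR2⟩ := ih (W ∪ Q) _ hS
      (by
        intro v hv
        rw [Finset.mem_union, not_or] at hv
        simp only [Finset.mem_sdiff, Finset.mem_insert, not_or]
        exact ⟨hout v hv.1, fun h => hv.1 (h ▸ h1), fun h => hv.1 (h ▸ h3), hv.2⟩)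
      (by
        intro e' he'
        obtain ⟨g1, g2, g3, g4, g5⟩ := hmem e' (Finset.mem_insert_of_mem he')
        have hne : e' ≠ e := fun h => he (h ▸ he')
        obtain ⟨d1, d2, d3, d4⟩ := hdis e' (Finset.mem_insert_of_mem he') e
          (Finset.mem_insert_self _ _) hne
        simp only [Finset.mem_union, Finset.mem_sdiff, Finset.mem_insert, not_or]
        exact ⟨Or.inl g1, ⟨g2, d1, d2, fun h => Finset.disjoint_left.1 hQW h g1⟩, Or.inl g3,
          ⟨g4, d3, d4, fun h => Finset.disjoint_left.1 hQW h g3⟩, g5⟩)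
      (fun e₁ h₁ e₂ h₂ => hdis e₁ (Finset.mem_insert_of_mem h₁) e₂ (Finset.mem_insert_of_mem h₂))
      (by nlinarith)
    have hne : ∀ e' ∈ E, e' ≠ e := fun e' he' h => he (h ▸ he')
    refine ⟨Function.update R e Q, ?_, ?_⟩
    · intro e' he'
      rcases Finset.mem_insert.1 he' with rfl | he'
      · rw [Function.update_self]; exact ⟨hQW, hw⟩
      · rw [Function.update_of_ne (hne e' he')]
        exact ⟨(hR1 e' he').1.mono_right Finset.subset_union_left, (hR1 e' he').2⟩
    · intro e₁ h₁ e₂ h₂ h12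
      rcases Finset.mem_insert.1 h₁ with rfl | g₁ <;> rcases Finset.mem_insert.1 h₂ with rfl | g₂
      · exact absurd rfl h12
      · rw [Function.update_self, Function.update_of_ne (hne _ g₂)]
        exact ((hR1 e₂ g₂).1.mono_right Finset.subset_union_right).symm
      · rw [Function.update_self, Function.update_of_ne (hne _ g₁)]
        exact (hR1 e₁ g₁).1.mono_right Finset.subset_union_right
      · rw [Function.update_of_ne (hne _ g₁), Function.update_of_ne (hne _ g₂)]
        exact hR2 e₁ g₁ e₂ g₂ h12

end Trees

section Assembly

lemma SimpleGraph.Walk.IsPath.mem_support_of_mem_tail_dropLast {V : Type*} {G : SimpleGraph V}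
    {u v : V} {p : G.Walk u v} (hp : p.IsPath) {x : V} (hx : x ∈ p.support.tail.dropLast) :
    x ∈ p.support ∧ x ≠ u ∧ x ≠ v := by
  have h1 : x ∈ p.support.tail := List.mem_of_mem_dropLast hx
  have hnd := hp.support_nodup
  refine ⟨List.mem_of_mem_tail h1, ?_, ?_⟩
  · rintro rfl
    rw [← SimpleGraph.Walk.cons_tail_support] at hnd
    exact (List.nodup_cons.1 hnd).1 h1
  · rintro rfl
    have hne : p.support.tail ≠ [] := List.ne_nil_of_mem h1
    have hnd' : p.support.tail.Nodup := hnd.tail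
    rw [← List.dropLast_append_getLast hne, List.nodup_append] at hnd'
    refine hnd'.2.2 x hx x ?_ rfl
    rw [List.mem_singleton, List.getLast_tail, SimpleGraph.Walk.getLast_support]

lemma hasTopClique_of_walks {V : Type*} {G : SimpleGraph V} {m : ℕ} (f : Fin m → V)
    (hf : Function.Injective f) (I : Fin m → Fin m → Set V)
    (hw : ∀ i j, i < j → ∃ w : G.Walk (f i) (f j), ∀ v ∈ w.support, v = f i ∨ v = f j ∨ v ∈ I i j)
    (hI : ∀ i j, i < j → ∀ k, f k ∉ I i j)
    (hdis : ∀ i j i' j', i < j → i' < j' → (i, j) ≠ (i', j') → Disjoint (I i j) (I i' j')) :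
    HasTopClique G m := by
  classical
  have hex : ∀ i j, ∃ p : G.Walk (f i) (f j), i < j → p.IsPath ∧
      ∀ v ∈ p.support, v = f i ∨ v = f j ∨ v ∈ I i j := by
    intro i j
    rcases lt_trichotomy i j with h | rfl | h
    · obtain ⟨w, hw⟩ := hw i j h
      exact ⟨w.bypass, fun _ => ⟨w.bypass_isPath,
        fun v hv => hw v (w.support_bypass_subset_support hv)⟩⟩
    · exact ⟨.nil, fun h => absurd h (lt_irrefl _)⟩
    · obtain ⟨w, _⟩ := hw j i h
      exact ⟨w.reverse, fun h' => absurd h' h.asymm⟩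
  choose P hP using hex
  have hmem : ∀ i j, i < j → ∀ v ∈ (P i j).support.tail.dropLast, v ∈ I i j := by
    intro i j hij v hv
    obtain ⟨h1, h2, h3⟩ := (hP i j hij).1.mem_support_of_mem_tail_dropLast hv
    have := (hP i j hij).2 v h1
    tauto
  refine ⟨f, hf, P, fun i j h => (hP i j h).1, fun i j h k hk => hI i j h k (hmem i j h _ hk), ?_⟩
  intro i j i' j' h h' hne x hx hx'
  exact Set.disjoint_left.1 (hdis i j i' j' h h' hne) (hmem i j h x hx) (hmem i' j' h' x hx')

variable {n ℓ : ℕ}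

lemma liftGraph_adj_of_lt {σ : Fin n → Fin n → Equiv.Perm (Fin ℓ)} {x y : Fin n × Fin ℓ}
    (h : x.1 < y.1) : (liftGraph n ℓ σ).Adj x y ↔ σ x.1 y.1 x.2 = y.2 := by
  rw [liftGraph, SimpleGraph.fromRel_adj]
  constructor
  · rintro ⟨_, h1 | h1⟩
    · exact h1.2
    · exact absurd h1.1 h.asymm
  · exact fun h1 => ⟨fun he => absurd h (he ▸ lt_irrefl _), Or.inl ⟨h, h1⟩⟩

/-- The neighbour in the fiber of `k ≠ 0` of the `i`-th branch vertex, where all branch vertices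
lie in the fiber of `0` and `ρ k` is the permutation between the fibers of `0` and `k`. -/
def terminal (ρ : Fin n → Equiv.Perm (Fin ℓ)) (hn : n ≤ ℓ) (k i : Fin n) : Fin n × Fin ℓ :=
  (k, ρ k (Fin.castLE hn i))

lemma terminal_inj {ρ : Fin n → Equiv.Perm (Fin ℓ)} {hn : n ≤ ℓ} {k i k' i' : Fin n} :
    terminal ρ hn k i = terminal ρ hn k' i' ↔ k = k' ∧ i = i' := by
  constructor
  · intro h
    simp only [terminal, Prod.mk.injEq] at h
    obtain ⟨rfl, h⟩ := h
    exact ⟨rfl, Fin.castLE_injective hn ((ρ k).injective h)⟩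
  · rintro ⟨rfl, rfl⟩; rfl

variable [NeZero n]

open Classical in
/-- The fiber of `0` together with all the terminals. -/
noncomputable def usedVerts (ρ : Fin n → Equiv.Perm (Fin ℓ)) (hn : n ≤ ℓ) :
    Finset (Fin n × Fin ℓ) :=
  Finset.univ.filter fun v => v.1 = 0 ∨ ∃ i, v = terminal ρ hn v.1 i

open Classical in
/-- The pairs of branch vertices that are not yet joined by an edge between the terminals which
the family `φ` assigns to them. -/
noncomputable def undone (σ : Fin n → Fin n → Equiv.Perm (Fin ℓ)) (hn : n ≤ ℓ)
    (φ : Fin n → Equiv.Perm (Fin n)) : Finset (Fin n × Fin n) :=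
  Finset.univ.filter fun e => e.1 ≠ e.2 ∧ ¬ (liftGraph n ℓ σ).Adj
    (terminal (σ 0) hn (φ e.1 e.2) e.1) (terminal (σ 0) hn (φ e.2 e.1) e.2)

lemma mem_undone {σ : Fin n → Fin n → Equiv.Perm (Fin ℓ)} {hn : n ≤ ℓ}
    {φ : Fin n → Equiv.Perm (Fin n)} {i j : Fin n} : (i, j) ∈ undone σ hn φ ↔
    i ≠ j ∧ ¬ (liftGraph n ℓ σ).Adj
    (terminal (σ 0) hn (φ i j) i) (terminal (σ 0) hn (φ j i) j) := by
  simp [undone]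

lemma undone_symm {σ : Fin n → Fin n → Equiv.Perm (Fin ℓ)} {hn : n ≤ ℓ}
    {φ : Fin n → Equiv.Perm (Fin n)} {i j : Fin n} (h : (i, j) ∈ undone σ hn φ) :
    (j, i) ∈ undone σ hn φ := by
  rw [mem_undone] at h ⊢
  exact ⟨h.1.symm, fun h' => h.2 h'.symm⟩

lemma branch_adj_terminal (σ : Fin n → Fin n → Equiv.Perm (Fin ℓ)) (hn : n ≤ ℓ) {k : Fin n}
    (hk : k ≠ 0) (i : Fin n) :
    (liftGraph n ℓ σ).Adj (0, Fin.castLE hn i) (terminal (σ 0) hn k i) := by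
  rw [liftGraph_adj_of_lt]
  · rfl
  · exact Fin.pos_iff_ne_zero.2 hk

/-- A topological clique is obtained by linking the remaining pairs of terminals. -/
lemma hasTopClique_of_undone {m h : ℕ} {σ : Fin n → Fin n → Equiv.Perm (Fin ℓ)} (hn : n ≤ ℓ)
    (hj : IsJoined (liftGraph n ℓ σ) m) (hm : 1 ≤ m) (hh : m < 2 ^ h)
    (φ : Fin n → Equiv.Perm (Fin n)) (hφ : ∀ i, φ i i = 0)
    (hexp : ∀ U : Finset (Fin n × Fin ℓ), (∀ u ∈ U, u.1 ≠ 0) → U.card ≤ 2 * m →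
      2 * U.card ≤ (nbrs (liftGraph n ℓ σ) U \ usedVerts (σ 0) hn).card)
    (hcard : (usedVerts (σ 0) hn).card + 7 * m + 2 * h * (undone σ hn φ).card ≤ n * ℓ) :
    HasTopClique (liftGraph n ℓ σ) n := by
  classical
  set t := terminal (σ 0) hn with ht
  have hφ0 : ∀ i j, i ≠ j → φ i j ≠ 0 := by
    intro i j hij h0
    exact hij ((φ i).injective ((hφ i).trans h0.symm))
  have htu : ∀ k i, t k i ∈ usedVerts (σ 0) hn := by
    intro k i
    rw [usedVerts, Finset.mem_filter]
    exact ⟨Finset.mem_univ _, Or.inr ⟨i, rfl⟩⟩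
  have hD : MeetsDemand (liftGraph n ℓ σ) m (usedVerts (σ 0) hn)
      (twoOn (Finset.univ.filter fun v : Fin n × Fin ℓ => v.1 ≠ 0)) := by
    intro U hU
    have h1 := hexp (U.filter fun v => v.1 ≠ 0) (fun u hu => (Finset.mem_filter.1 hu).2)
      ((Finset.card_filter_le _ _).trans hU)
    have h2 : (nbrs (liftGraph n ℓ σ) (U.filter fun v => v.1 ≠ 0) \ usedVerts (σ 0) hn).card ≤
        (nbrs (liftGraph n ℓ σ) U \ usedVerts (σ 0) hn).card :=
      Finset.card_le_card (Finset.sdiff_subset_sdiff (nbrs_mono (Finset.filter_subset _ _))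
        subset_rfl)
    have h3 : ∑ u ∈ U, twoOn (Finset.univ.filter fun v : Fin n × Fin ℓ => v.1 ≠ 0) u =
        2 * ((U.filter fun v => v.1 ≠ 0).card : ℤ) := by
      simp only [twoOn, Finset.mem_filter, Finset.mem_univ, true_and]
      rw [← Finset.sum_filter, Finset.sum_const, nsmul_eq_mul, mul_comm]
    rw [h3]
    exact_mod_cast h1.trans h2
  set E := (undone σ hn φ).filter fun e => e.1 < e.2 with hEdef
  have hEne : ∀ e ∈ E, e.1 < e.2 := fun e he => (Finset.mem_filter.1 he).2
  obtain ⟨Q, hQ, hQd⟩ := MeetsDemand.exists_linking hj hm hh (fun e => t (φ e.1 e.2) e.1)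
    (fun e => t (φ e.2 e.1) e.2) E _ _ hD (by
      intro v hv
      simp only [Finset.mem_filter, Finset.mem_univ, true_and]
      intro h0
      exact hv (by simp [usedVerts, h0])) (by
      intro e he
      have hlt := hEne e he
      refine ⟨htu _ _, ?_, htu _ _, ?_, ?_⟩
      · simpa [ht, terminal] using hφ0 _ _ hlt.ne
      · simpa [ht, terminal] using hφ0 _ _ hlt.ne'
      · rw [ht, Ne, terminal_inj]
        exact fun h => hlt.ne h.2) (by
      rintro ⟨i, j⟩ he ⟨i', j'⟩ he' hne
      have hlt := hEne _ he
      have hlt' := hEne _ he'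
      simp only [ht, Ne, terminal_inj]
      refine ⟨?_, ?_, ?_, ?_⟩
      · rintro ⟨h1, rfl⟩
        exact hne (by rw [(φ i).injective h1])
      · rintro ⟨h1, rfl⟩
        have := (φ i).injective h1
        subst this
        exact hlt.asymm hlt'
      · rintro ⟨h1, rfl⟩
        have := (φ j).injective h1
        subst this
        exact hlt.asymm hlt'
      · rintro ⟨h1, rfl⟩
        exact hne (by rw [(φ j).injective h1])) (by
      have h1 : E.card ≤ (undone σ hn φ).card := Finset.card_filter_le _ _
      have h2 : 2 * h * E.card ≤ 2 * h * (undone σ hn φ).card := Nat.mul_le_mul_left _ h1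
      simp only [Fintype.card_prod, Fintype.card_fin]
      omega)
  let R : Fin n → Fin n → Set (Fin n × Fin ℓ) := fun i j =>
    if (i, j) ∈ E then (Q (i, j) : Set _) else ∅
  have hRu : ∀ i j v, v ∈ R i j → v ∉ usedVerts (σ 0) hn := by
    intro i j v hv
    simp only [R] at hv
    split_ifs at hv with he
    · exact Finset.disjoint_left.1 (hQ _ he).1 hv
    · exact absurd hv (by simp)
  refine hasTopClique_of_walks (fun i => (0, Fin.castLE hn i)) ?_
    (fun i j => {t (φ i j) i, t (φ j i) j} ∪ R i j) ?_ ?_ ?_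
  · intro i j hij
    exact Fin.castLE_injective hn (Prod.ext_iff.1 hij).2
  · intro i j hij
    have a1 := branch_adj_terminal σ hn (hφ0 i j hij.ne) i
    have a2 := (branch_adj_terminal σ hn (hφ0 j i hij.ne') j).symm
    have hw : ∃ w : (liftGraph n ℓ σ).Walk (t (φ i j) i) (t (φ j i) j),
        ∀ v ∈ w.support, v = t (φ i j) i ∨ v = t (φ j i) j ∨ v ∈ R i j := by
      by_cases he : (i, j) ∈ E
      · obtain ⟨w, hw⟩ := (hQ _ he).2
        refine ⟨w, fun v hv => ?_⟩
        simpa [R, he] using hw v hv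
      · have hadj : (liftGraph n ℓ σ).Adj (t (φ i j) i) (t (φ j i) j) := by
          by_contra hna
          exact he (Finset.mem_filter.2 ⟨mem_undone.2 ⟨hij.ne, hna⟩, hij⟩)
        refine ⟨hadj.toWalk, fun v hv => ?_⟩
        simp at hv
        tauto
    obtain ⟨w, hw⟩ := hw
    refine ⟨.cons a1 (w.concat a2), fun v hv => ?_⟩
    rw [SimpleGraph.Walk.support_cons, SimpleGraph.Walk.support_concat] at hv
    simp only [List.mem_cons, List.mem_append, List.not_mem_nil, or_false] at hv
    simp only [Set.mem_union, Set.mem_insert_iff, Set.mem_singleton_iff]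
    rcases hv with hv | hv | hv
    · tauto
    · have := hw v hv; tauto
    · tauto
  · intro i j hij k hk
    simp only [Set.mem_union, Set.mem_insert_iff, Set.mem_singleton_iff] at hk
    rcases hk with (hk | hk) | hk
    · exact hφ0 i j hij.ne (Prod.ext_iff.1 hk).1.symm
    · exact hφ0 j i hij.ne' (Prod.ext_iff.1 hk).1.symm
    · exact hRu _ _ _ hk (by simp [usedVerts])
  · intro i j i' j' hij hij' hne
    rw [Set.disjoint_left]
    intro v hv hv'
    simp only [Set.mem_union, Set.mem_insert_iff, Set.mem_singleton_iff] at hv hv'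
    rcases hv with hv | hv <;> rcases hv' with hv' | hv'
    · rcases hv with rfl | rfl <;> rcases hv' with hv' | hv' <;> rw [ht, terminal_inj] at hv' <;>
        obtain ⟨h1, rfl⟩ := hv'
      · exact hne (by rw [(φ i).injective h1])
      · have := (φ i).injective h1
        subst this
        exact hij.asymm hij'
      · have := (φ j).injective h1
        subst this
        exact hij.asymm hij'
      · exact hne (by rw [(φ j).injective h1])
    · refine hRu _ _ _ hv' ?_
      rcases hv with rfl | rfl <;> exact htu _ _
    · refine hRu _ _ _ hv ?_
      rcases hv' with rfl | rfl <;> exact htu _ _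
    · simp only [R] at hv hv'
      split_ifs at hv hv' with he he'
      · exact Finset.disjoint_left.1 (hQd _ he _ he' hne) hv hv'
      all_goals simp at hv hv'

end Assembly

section Switching

variable {n ℓ : ℕ}

/-- The pairs of terminals an edge between which allows one to decrease the set `H` of
unfinished pairs of branch vertices by two transpositions. -/
def switchPairs (ρ : Fin n → Equiv.Perm (Fin ℓ)) (hn : n ≤ ℓ) (φ : Fin n → Equiv.Perm (Fin n))
    (H : Finset (Fin n × Fin n)) : Finset ((Fin n × Fin ℓ) × (Fin n × Fin ℓ)) :=
  (H.sigma fun e => (H.filter fun e' => e'.1 = e.1) ×ˢ (H.filter fun e' => e'.1 = e.2)).image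
    fun x => (terminal ρ hn (φ x.1.1 x.2.1.2) x.1.1, terminal ρ hn (φ x.1.2 x.2.2.2) x.1.2)

lemma exists_undone_ssubset [NeZero n] {σ : Fin n → Fin n → Equiv.Perm (Fin ℓ)} {hn : n ≤ ℓ}
    {φ : Fin n → Equiv.Perm (Fin n)} (hφ : ∀ i, φ i i = 0) {p : (Fin n × Fin ℓ) × (Fin n × Fin ℓ)}
    (hp : p ∈ switchPairs (σ 0) hn φ (undone σ hn φ)) (hadj : (liftGraph n ℓ σ).Adj p.1 p.2) :
    ∃ φ' : Fin n → Equiv.Perm (Fin n), (∀ i, φ' i i = 0) ∧ undone σ hn φ' ⊂ undone σ hn φ := by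
  simp only [switchPairs, Finset.mem_image, Finset.mem_sigma, Finset.mem_product,
    Finset.mem_filter] at hp
  obtain ⟨⟨⟨i, j⟩, ⟨⟨i₁, j'⟩, ⟨j₁, i'⟩⟩⟩, ⟨hij, ⟨hij', h1⟩, hji', h2⟩, rfl⟩ := hp
  dsimp only at *
  subst h1 h2
  have hne := (mem_undone.1 hij).1
  have hne1 := (mem_undone.1 hij').1
  have hne2 := (mem_undone.1 hji').1
  set φ' : Fin n → Equiv.Perm (Fin n) := fun k => if k = i₁ then φ i₁ * Equiv.swap j₁ j'
    else if k = j₁ then φ j₁ * Equiv.swap i₁ i' else φ k with hφ'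
  have e1 : φ' i₁ j₁ = φ i₁ j' := by simp [hφ']
  have e2 : φ' j₁ i₁ = φ j₁ i' := by simp [hφ', hne.symm]
  have key : ∀ a b, (a, b) ∉ undone σ hn φ → φ' a b = φ a b := by
    intro a b hab
    simp only [hφ']
    split_ifs with ha hb
    · subst ha
      rw [Equiv.Perm.mul_apply, Equiv.swap_apply_of_ne_of_ne]
      · rintro rfl; exact hab hij
      · rintro rfl; exact hab hij'
    · subst hb
      rw [Equiv.Perm.mul_apply, Equiv.swap_apply_of_ne_of_ne]
      · rintro rfl; exact hab (undone_symm hij)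
      · rintro rfl; exact hab hji'
    · rfl
  refine ⟨φ', fun k => ?_, ?_⟩
  · rw [key k k (fun h => (mem_undone.1 h).1 rfl), hφ]
  · rw [Finset.ssubset_iff_of_subset]
    · refine ⟨(i₁, j₁), hij, fun h => (mem_undone.1 h).2 ?_⟩
      rw [e1, e2]
      exact hadj
    · rintro ⟨a, b⟩ hab
      by_contra hab'
      have hba' : (b, a) ∉ undone σ hn φ := fun h => hab' (undone_symm h)
      refine hab' (mem_undone.2 ⟨(mem_undone.1 hab).1, ?_⟩)
      rw [← key a b hab', ← key b a hba']
      exact (mem_undone.1 hab).2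

lemma exists_no_adj_switchPairs [NeZero n] (σ : Fin n → Fin n → Equiv.Perm (Fin ℓ)) (hn : n ≤ ℓ) :
    ∃ φ : Fin n → Equiv.Perm (Fin n), (∀ i, φ i i = 0) ∧
      ∀ p ∈ switchPairs (σ 0) hn φ (undone σ hn φ), ¬ (liftGraph n ℓ σ).Adj p.1 p.2 := by
  by_contra! hcon
  have hall : ∀ N : ℕ, ∀ φ : Fin n → Equiv.Perm (Fin n), (∀ i, φ i i = 0) →
      (undone σ hn φ).card ≠ N := by
    intro N
    induction N using Nat.strong_induction_on with
    | _ N ih =>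
      rintro φ hφ rfl
      obtain ⟨p, hp, hadj⟩ := hcon φ hφ
      obtain ⟨φ', hφ', hss⟩ := exists_undone_ssubset hφ hp hadj
      exact ih _ (Finset.card_lt_card hss) φ' hφ' rfl
  exact hall _ (fun i => Equiv.swap 0 i) (fun i => Equiv.swap_apply_right 0 i) rfl

lemma three_mul_sq_sub_le {D u v : ℝ} (hD : 0 ≤ D) (hu : 0 < u) (hv : 0 < v) :
    3 * D ^ 2 - D ^ 3 * (1 / u + 1 / v) ≤ u * v := by
  obtain ⟨w, hw, hw2⟩ : ∃ w : ℝ, 0 < w ∧ w ^ 2 = u * v :=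
    ⟨√(u * v), Real.sqrt_pos.2 (by positivity), Real.sq_sqrt (by positivity)⟩
  have h1 : 2 * w ≤ u + v := by
    refine abs_le_of_sq_le_sq' ?_ (by positivity) |>.2
    nlinarith [sq_nonneg (u - v)]
  have h2 : 1 / u + 1 / v = (u + v) / w ^ 2 := by
    rw [hw2]; field_simp; ring
  rw [h2, ← hw2, sub_le_iff_le_add, ← sub_le_iff_le_add']
  have h3 : 3 * D ^ 2 - w ^ 2 ≤ D ^ 3 * ((2 * w) / w ^ 2) := by
    rw [mul_div_assoc', le_div_iff₀ (by positivity)]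
    nlinarith [mul_nonneg hw.le (mul_nonneg (sq_nonneg (w - D)) (by positivity : 0 ≤ w + 2 * D))]
  refine h3.trans ?_
  gcongr

lemma sum_inv_card_fiber_le {α β : Type*} [DecidableEq β] [Fintype β] (H : Finset α) (f : α → β) :
    ∑ e ∈ H, 1 / ((H.filter fun e' => f e' = f e).card : ℝ) ≤ Fintype.card β := by
  rw [Finset.sum_comp (fun b => 1 / ((H.filter fun e' => f e' = b).card : ℝ)) f]
  calc _ ≤ ∑ b ∈ H.image f, (1 : ℝ) := by
        refine Finset.sum_le_sum fun b _ => ?_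
        rw [nsmul_eq_mul, mul_one_div]
        exact div_self_le_one _
    _ ≤ _ := by
        rw [Finset.sum_const, nsmul_eq_mul, mul_one]
        exact_mod_cast Finset.card_le_univ _

/-- A lower bound on the number of walks of length three in a symmetric relation. -/
lemma card_pow_three_le_card_switchPairs (ρ : Fin n → Equiv.Perm (Fin ℓ)) (hn : n ≤ ℓ)
    (φ : Fin n → Equiv.Perm (Fin n)) {H : Finset (Fin n × Fin n)}
    (hH : ∀ i j, (i, j) ∈ H → (j, i) ∈ H) (h0 : 0 < n) :
    (H.card : ℝ) ^ 3 ≤ n ^ 2 * ((switchPairs ρ hn φ H).card : ℝ) := by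
  have hcard : (switchPairs ρ hn φ H).card =
      ∑ e ∈ H, (H.filter fun e' => e'.1 = e.1).card * (H.filter fun e' => e'.1 = e.2).card := by
    rw [switchPairs, Finset.card_image_of_injOn]
    · rw [Finset.card_sigma]
      simp only [Finset.card_product]
    · rintro ⟨⟨i, j⟩, ⟨⟨i₁, j'⟩, ⟨j₁, i'⟩⟩⟩ hx ⟨⟨a, b⟩, ⟨⟨a₁, b'⟩, ⟨b₁, a'⟩⟩⟩ hy hxy
      simp only [Finset.coe_sigma, Finset.coe_product, Set.mem_sigma_iff, Finset.mem_coe,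
        Set.mem_prod, Finset.mem_filter] at hx hy
      obtain ⟨-, ⟨-, rfl⟩, -, rfl⟩ := hx
      obtain ⟨-, ⟨-, rfl⟩, -, rfl⟩ := hy
      simp only [Prod.mk.injEq, terminal_inj] at hxy
      obtain ⟨⟨h1, rfl⟩, h2, rfl⟩ := hxy
      rw [(φ _).injective h1, (φ _).injective h2]
  have hsw : ∀ j, (H.filter fun e' => e'.2 = j).card = (H.filter fun e' => e'.1 = j).card := by
    intro j
    refine Finset.card_nbij' Prod.swap Prod.swap ?_ ?_ (fun _ _ => rfl) (fun _ _ => rfl)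
    · rintro ⟨a, b⟩ h
      simp only [Finset.coe_filter, Set.mem_ofPred_eq] at h ⊢
      exact ⟨hH _ _ h.1, h.2⟩
    · rintro ⟨a, b⟩ h
      simp only [Finset.coe_filter, Set.mem_ofPred_eq] at h ⊢
      exact ⟨hH _ _ h.1, h.2⟩
  set s : ℝ := (H.card : ℝ) with hs
  have hn0 : (0 : ℝ) < n := by exact_mod_cast h0
  have hD : 0 ≤ s / n := by positivity
  have h1 : ∑ e ∈ H, (3 * (s / n) ^ 2 - (s / n) ^ 3 *
      (1 / ((H.filter fun e' => e'.1 = e.1).card : ℝ) +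
        1 / ((H.filter fun e' => e'.1 = e.2).card : ℝ))) ≤ ((switchPairs ρ hn φ H).card : ℝ) := by
    rw [hcard]
    push_cast
    refine Finset.sum_le_sum fun e he => three_mul_sq_sub_le hD ?_ ?_
    · exact Nat.cast_pos.2 (Finset.card_pos.2 ⟨e, Finset.mem_filter.2 ⟨he, rfl⟩⟩)
    · exact Nat.cast_pos.2
        (Finset.card_pos.2 ⟨(e.2, e.1), Finset.mem_filter.2 ⟨hH _ _ he, rfl⟩⟩)
  have h2 := sum_inv_card_fiber_le H (Prod.fst : Fin n × Fin n → Fin n)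
  have h3 := sum_inv_card_fiber_le H (Prod.snd : Fin n × Fin n → Fin n)
  simp only [hsw, Fintype.card_fin] at h2 h3
  rw [Finset.sum_sub_distrib, Finset.sum_const, nsmul_eq_mul, ← Finset.mul_sum,
    Finset.sum_add_distrib, ← hs] at h1
  have h4 : s * (3 * (s / n) ^ 2) - (s / n) ^ 3 * (n + n) ≤ (switchPairs ρ hn φ H).card := by
    refine le_trans ?_ h1
    gcongr
  have h5 : s * (3 * (s / n) ^ 2) - (s / n) ^ 3 * (n + n) = s ^ 3 / n ^ 2 := by
    field_simp; ring
  rw [h5, div_le_iff₀ (by positivity)] at h4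
  linarith

end Switching

section Permutations

open Equiv

variable {α : Type*} [Fintype α] [DecidableEq α]

lemma card_compl_mul_card_filter_le {A C : Finset α} {b : α} {S : Finset (Perm α)}
    (hS : ∀ σ ∈ S, ∀ a ∉ A, σ * swap b a ∈ S) {w : ℝ}
    (hw : ∀ σ ∈ S, ((Aᶜ.filter fun a => σ a ∈ C).card : ℝ) ≤ w) :
    (Aᶜ.card : ℝ) * ((S.filter fun σ => σ b ∈ C).card : ℝ) ≤ w * S.card := by
  have h1 : ∀ a ∈ Aᶜ, (S.filter fun σ => σ a ∈ C).card = (S.filter fun σ => σ b ∈ C).card := by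
    intro a ha
    rw [Finset.mem_compl] at ha
    refine Finset.card_nbij' (· * swap b a) (· * swap b a) ?_ ?_ ?_ ?_
    · intro σ hσ
      simp only [Finset.coe_filter, Set.mem_ofPred_eq] at hσ ⊢
      exact ⟨hS _ hσ.1 _ ha, by simpa using hσ.2⟩
    · intro σ hσ
      simp only [Finset.coe_filter, Set.mem_ofPred_eq] at hσ ⊢
      exact ⟨hS _ hσ.1 _ ha, by simpa using hσ.2⟩
    · intro σ _; simp [mul_assoc]
    · intro σ _; simp [mul_assoc]
  have h2 : Aᶜ.card * (S.filter fun σ => σ b ∈ C).card =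
      ∑ σ ∈ S, (Aᶜ.filter fun a => σ a ∈ C).card := by
    rw [← smul_eq_mul, ← Finset.sum_const, ← Finset.sum_congr rfl h1]
    exact Finset.sum_card_bipartiteAbove_eq_sum_card_bipartiteBelow (fun a (σ : Perm α) => σ a ∈ C)
  rw [← Nat.cast_mul, h2, Nat.cast_sum]
  refine (Finset.sum_le_sum hw).trans ?_
  rw [Finset.sum_const, nsmul_eq_mul, mul_comm]

lemma card_filter_forall_mem_le (C : α → Finset α) {q : ℝ} (hq : 0 ≤ q) (A : Finset α)
    (h : ∀ A' ⊆ A, ∀ b ∈ A \ A', ∀ σ : Perm α, (∀ a ∈ A', σ a ∈ C a) →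
      ((A'ᶜ.filter fun a => σ a ∈ C b).card : ℝ) ≤ q * A'ᶜ.card) :
    ((Finset.univ.filter fun σ : Perm α => ∀ a ∈ A, σ a ∈ C a).card : ℝ) ≤
      q ^ A.card * (Fintype.card α).factorial := by
  induction A using Finset.induction_on with
  | empty => simp [Fintype.card_perm]
  | insert b A hb ih =>
    have ih := ih fun A' hA' b' hb' σ hσ => h A' (hA'.trans (Finset.subset_insert _ _)) b'
      (Finset.sdiff_subset_sdiff (Finset.subset_insert _ _) subset_rfl hb') σ hσ
    set S := Finset.univ.filter fun σ : Perm α => ∀ a ∈ A, σ a ∈ C a with hS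
    have h1 : (Finset.univ.filter fun σ : Perm α => ∀ a ∈ insert b A, σ a ∈ C a) =
        S.filter fun σ => σ b ∈ C b := by
      ext σ
      simp [hS, and_comm]
    have hpos : (0 : ℝ) < Aᶜ.card :=
      Nat.cast_pos.2 (Finset.card_pos.2 ⟨b, Finset.mem_compl.2 hb⟩)
    have h2 := card_compl_mul_card_filter_le (A := A) (C := C b) (b := b) (S := S)
      (w := q * Aᶜ.card) (by
        intro σ hσ a ha
        simp only [hS, Finset.mem_filter, Finset.mem_univ, true_and] at hσ ⊢
        intro a' ha'
        rw [Perm.mul_apply, swap_apply_of_ne_of_ne]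
        · exact hσ a' ha'
        · rintro rfl; exact hb ha'
        · rintro rfl; exact ha ha')
      (fun σ hσ => h A (Finset.subset_insert _ _) b (by simp [hb]) σ (Finset.mem_filter.1 hσ).2)
    rw [h1, Finset.card_insert_of_notMem hb, pow_succ]
    have h3 : ((S.filter fun σ => σ b ∈ C b).card : ℝ) ≤ q * S.card := by
      rw [← mul_le_mul_iff_right₀ hpos]
      linarith
    calc _ ≤ q * S.card := h3
      _ ≤ q * (q ^ A.card * (Fintype.card α).factorial) := by gcongr
      _ = _ := by ring

/-- The proportion of permutations mapping `A` into `C`. -/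
lemma card_perm_mapsTo_le {A C : Finset α} {S : Finset (Perm α)}
    (hS : ∀ σ ∈ S, ∀ a ∈ A, σ a ∈ C) :
    (S.card : ℝ) ≤ (C.card / Fintype.card α : ℝ) ^ A.card * (Fintype.card α).factorial := by
  refine le_trans (Nat.cast_le.2 (Finset.card_le_card fun σ hσ =>
    Finset.mem_filter.2 ⟨Finset.mem_univ _, hS σ hσ⟩)) ?_
  refine card_filter_forall_mem_le (fun _ => C) (by positivity) A fun A' _ b _ σ hσ => ?_
  have h0 : (0 : ℝ) < Fintype.card α := Nat.cast_pos.2 (Fintype.card_pos_iff.2 ⟨b⟩)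
  have h1 : (A'ᶜ.filter fun a => σ a ∈ C).card + A'.card ≤ C.card := by
    rw [← Finset.card_union_of_disjoint]
    · refine Finset.card_le_card_of_injOn σ (fun a ha => ?_) σ.injective.injOn
      simp only [Finset.coe_union, Set.mem_union, Finset.mem_coe, Finset.mem_filter] at ha ⊢
      exact ha.elim (fun h => h.2) (hσ a)
    · rw [Finset.disjoint_left]
      intro a ha ha'
      exact Finset.mem_compl.1 (Finset.mem_filter.1 ha).1 ha'
  have h2 : (A'ᶜ.card : ℝ) = Fintype.card α - A'.card := by
    rw [Finset.card_compl, Nat.cast_sub (Finset.card_le_univ _)]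
  have h3 : (C.card : ℝ) ≤ Fintype.card α := Nat.cast_le.2 (Finset.card_le_univ _)
  have h4 : ((A'ᶜ.filter fun a => σ a ∈ C).card : ℝ) + A'.card ≤ C.card := by exact_mod_cast h1
  rw [h2, div_mul_eq_mul_div, le_div_iff₀ h0]
  nlinarith [(Nat.cast_nonneg A'.card : (0 : ℝ) ≤ _)]

/-- The proportion of permutations whose graph avoids `Z`. -/
lemma card_perm_avoid_le [Nonempty α] (Z : Finset (α × α)) :
    ((Finset.univ.filter fun σ : Perm α => ∀ a, (a, σ a) ∉ Z).card : ℝ) ≤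
      Real.exp (-((Z.card : ℝ) ^ 2 / (16 * (Fintype.card α : ℝ) ^ 3))) *
        (Fintype.card α).factorial := by
  set ℓ := Fintype.card α with hℓ
  have h0 : (0 : ℝ) < ℓ := Nat.cast_pos.2 Fintype.card_pos
  set d : ℝ := Z.card / (2 * ℓ) with hd
  have hd0 : 0 ≤ d := by positivity
  have hZ : (Z.card : ℝ) = 2 * ℓ * d := by rw [hd]; field_simp
  clear_value d
  let r : α → Finset α := fun a => Finset.univ.filter fun b => (a, b) ∈ Z
  have hr : ∀ a, ((r a).card : ℝ) ≤ ℓ := fun a => Nat.cast_le.2 (Finset.card_le_univ _)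
  have hZr : Z.card = ∑ a, (r a).card := by
    rw [Finset.card_eq_sum_card_fiberwise (f := Prod.fst) (t := Finset.univ)
      (fun _ _ => Finset.mem_coe.2 (Finset.mem_univ _))]
    refine Finset.sum_congr rfl fun a _ => ?_
    refine Finset.card_nbij' Prod.snd (fun b => (a, b)) ?_ ?_ ?_ ?_
    · rintro ⟨x, b⟩ h
      simp only [Finset.coe_filter, Set.mem_ofPred_eq] at h
      obtain ⟨h, rfl⟩ := h
      simpa [r] using h
    · intro b hb
      simpa [r] using hb
    · rintro ⟨x, b⟩ h
      simp only [Finset.coe_filter, Set.mem_ofPred_eq] at h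
      rw [← h.2]
    · intro b _; rfl
  set B := Finset.univ.filter fun a => d ≤ (r a).card with hB
  have hBd : d ≤ B.card := by
    have h1 : (Z.card : ℝ) ≤ ∑ a, ((if a ∈ B then (ℓ : ℝ) else 0) + d) := by
      rw [hZr, Nat.cast_sum]
      refine Finset.sum_le_sum fun a _ => ?_
      split_ifs with ha
      · linarith [hr a]
      · have := lt_of_not_ge fun h => ha (Finset.mem_filter.2 ⟨Finset.mem_univ _, h⟩)
        linarith
    rw [Finset.sum_add_distrib, Finset.sum_const, Finset.card_univ, ← hℓ, ← Finset.sum_filter,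
      Finset.sum_const, nsmul_eq_mul, nsmul_eq_mul, Finset.filter_mem_eq_inter,
      Finset.univ_inter, hZ] at h1
    nlinarith
  have hceil : ⌈d / 2⌉₊ ≤ B.card := Nat.ceil_le.2 (by linarith)
  obtain ⟨A, hAB, hA⟩ := Finset.exists_subset_card_eq hceil
  have hdℓ : d ≤ ℓ := hBd.trans (Nat.cast_le.2 (Finset.card_le_univ _))
  have hq : 0 ≤ 1 - d / (2 * ℓ) := by
    rw [sub_nonneg, div_le_one (by positivity)]
    linarith
  have key := card_filter_forall_mem_le (fun a => (r a)ᶜ) hq A (by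
    intro A' hA' b hb σ _
    rw [Finset.mem_sdiff] at hb
    have h1 : (A'ᶜ.filter fun a => σ a ∈ (r b)ᶜ).card ≤ (r b)ᶜ.card :=
      Finset.card_le_card_of_injOn σ (fun a ha => (Finset.mem_filter.1 ha).2) σ.injective.injOn
    have h2 : ((r b)ᶜ.card : ℝ) ≤ ℓ - d := by
      rw [Finset.card_compl, Nat.cast_sub (Finset.card_le_univ _)]
      have := (Finset.mem_filter.1 (hAB hb.1)).2
      linarith
    have h3 : (A'.card : ℝ) ≤ d / 2 := by
      have h4 : A'.card < ⌈d / 2⌉₊ := hA ▸ Finset.card_lt_card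
        ((Finset.ssubset_iff_of_subset hA').2 ⟨b, hb.1, hb.2⟩)
      exact (Nat.lt_ceil.1 h4).le
    have h5 : (A'ᶜ.card : ℝ) = ℓ - A'.card := by
      rw [Finset.card_compl, Nat.cast_sub (Finset.card_le_univ _)]
    have h6 : (ℓ : ℝ) - d ≤ (1 - d / (2 * ℓ)) * (ℓ - d / 2) := by
      have h7 : (1 - d / (2 * ℓ)) * (ℓ - d / 2) = ℓ - d + d ^ 2 / (4 * ℓ) := by
        field_simp; ring
      rw [h7]
      have : 0 ≤ d ^ 2 / (4 * ℓ) := by positivity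
      linarith
    calc _ ≤ ((r b)ᶜ.card : ℝ) := Nat.cast_le.2 h1
      _ ≤ (1 - d / (2 * ℓ)) * (ℓ - d / 2) := h2.trans h6
      _ ≤ _ := by
        rw [h5]
        gcongr)
  refine le_trans ?_ (key.trans ?_)
  · refine Nat.cast_le.2 (Finset.card_le_card fun σ hσ => ?_)
    simp only [Finset.mem_filter, Finset.mem_univ, true_and] at hσ ⊢
    intro a _
    simpa [r] using hσ a
  · gcongr
    rw [hA]
    calc (1 - d / (2 * ℓ)) ^ ⌈d / 2⌉₊ ≤ Real.exp (-(d / (2 * ℓ))) ^ ⌈d / 2⌉₊ := by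
          gcongr
          linarith [Real.add_one_le_exp (-(d / (2 * ℓ)))]
      _ = Real.exp (-(d / (2 * ℓ) * ⌈d / 2⌉₊)) := by
          rw [← Real.exp_nat_mul]; congr 1; ring
      _ ≤ _ := by
          rw [Real.exp_le_exp, neg_le_neg_iff]
          calc (Z.card : ℝ) ^ 2 / (16 * (ℓ : ℝ) ^ 3) = d / (2 * ℓ) * (d / 2) := by
                rw [hZ]; field_simp; ring
            _ ≤ _ := by gcongr; exact Nat.le_ceil _

end Permutations

section RandomLifts

open Equiv

variable {n ℓ : ℕ}

/-- A union bound over events that, given the permutations between the fiber of `0` and the other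
fibers, restrict the other permutations independently of each other. -/
lemma card_exists_forall_mem_le [NeZero n] {ι : Type*} [DecidableEq ι] (I : Finset ι)
    (E : (Fin n → Perm (Fin ℓ)) → ι → Fin n → Fin n → Finset (Perm (Fin ℓ)))
    (w : (Fin n → Perm (Fin ℓ)) → ι → Fin n → Fin n → ℝ) (W : ι → ℝ)
    (hE : ∀ ρ, ∀ c ∈ I, ∀ k k', k ≠ 0 → ((E ρ c k k').card : ℝ) ≤ w ρ c k k' * ℓ.factorial)
    (hw : ∀ ρ, ∀ c ∈ I, ∏ k ∈ Finset.univ.erase 0, ∏ k', w ρ c k k' ≤ W c)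
    (S : Finset (Fin n → Fin n → Perm (Fin ℓ)))
    (hS : ∀ σ ∈ S, ∃ c ∈ I, ∀ k k', k ≠ 0 → σ k k' ∈ E (σ 0) c k k') :
    (S.card : ℝ) ≤ (∑ c ∈ I, W c) * Fintype.card (Fin n → Fin n → Perm (Fin ℓ)) := by
  classical
  let X : (Fin n → Perm (Fin ℓ)) → ι → Finset (Fin n → Fin n → Perm (Fin ℓ)) := fun ρ c =>
    Fintype.piFinset fun k => if k = 0 then {ρ} else Fintype.piFinset fun k' => E ρ c k k'
  have hsub : S ⊆ Finset.univ.biUnion fun ρ => I.biUnion fun c => X ρ c := by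
    intro σ hσ
    obtain ⟨c, hc, h⟩ := hS σ hσ
    simp only [Finset.mem_biUnion, Finset.mem_univ, true_and]
    refine ⟨σ 0, c, hc, Fintype.mem_piFinset.2 fun k => ?_⟩
    split_ifs with hk
    · rw [hk]; exact Finset.mem_singleton_self _
    · exact Fintype.mem_piFinset.2 fun k' => h k k' hk
  have hX : ∀ ρ, ∀ c ∈ I, ((X ρ c).card : ℝ) ≤ W c * ((ℓ.factorial : ℝ) ^ n) ^ (n - 1) := by
    intro ρ c hc
    have h1 : (X ρ c).card = ∏ k ∈ Finset.univ.erase 0, ∏ k', (E ρ c k k').card := by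
      rw [Fintype.card_piFinset, ← Finset.mul_prod_erase _ _ (Finset.mem_univ (0 : Fin n))]
      rw [if_pos rfl, Finset.card_singleton, one_mul]
      refine Finset.prod_congr rfl fun k hk => ?_
      rw [if_neg (Finset.ne_of_mem_erase hk), Fintype.card_piFinset]
    rw [h1]
    push_cast
    calc _ ≤ ∏ k ∈ Finset.univ.erase 0, ∏ k', (w ρ c k k' * ℓ.factorial) := by
          refine Finset.prod_le_prod
            (fun _ _ => Finset.prod_nonneg fun _ _ => Nat.cast_nonneg _) fun k hk => ?_
          exact Finset.prod_le_prod (fun _ _ => Nat.cast_nonneg _) fun k' _ =>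
            hE ρ c hc k k' (Finset.ne_of_mem_erase hk)
      _ = (∏ k ∈ Finset.univ.erase 0, ∏ k', w ρ c k k') * ((ℓ.factorial : ℝ) ^ n) ^ (n - 1) := by
          simp only [Finset.prod_mul_distrib, Finset.prod_const, Finset.card_univ,
            Fintype.card_fin, Finset.card_erase_of_mem (Finset.mem_univ (0 : Fin n))]
      _ ≤ _ := mul_le_mul_of_nonneg_right (hw ρ c hc)
          (pow_nonneg (pow_nonneg (Nat.cast_nonneg _) _) _)
  have hcard : (Fintype.card (Fin n → Fin n → Perm (Fin ℓ)) : ℝ) =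
      (ℓ.factorial : ℝ) ^ n * ((ℓ.factorial : ℝ) ^ n) ^ (n - 1) := by
    simp only [Fintype.card_pi, Finset.prod_const, Finset.card_univ, Fintype.card_fin,
      Fintype.card_perm]
    push_cast
    rw [← pow_succ', Nat.sub_add_cancel (NeZero.one_le)]
  calc (S.card : ℝ) ≤ ∑ ρ : Fin n → Perm (Fin ℓ), ∑ c ∈ I, ((X ρ c).card : ℝ) := by
        exact_mod_cast (Finset.card_le_card hsub).trans (Finset.card_biUnion_le.trans
          (Finset.sum_le_sum fun ρ _ => Finset.card_biUnion_le))
    _ ≤ ∑ ρ : Fin n → Perm (Fin ℓ), ∑ c ∈ I, W c * ((ℓ.factorial : ℝ) ^ n) ^ (n - 1) :=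
        Finset.sum_le_sum fun ρ _ => Finset.sum_le_sum fun c hc => hX ρ c hc
    _ = _ := by
        rw [hcard, ← Finset.sum_mul, Finset.sum_const, Finset.card_univ, Fintype.card_pi]
        simp only [Fintype.card_perm, Fintype.card_fin, Finset.prod_const, Finset.card_univ]
        push_cast [nsmul_eq_mul]
        ring

/-- The part of `R` between the fibers of `k` and `k'`, for `k < k'`. -/
def fiberPairs (R : Finset ((Fin n × Fin ℓ) × (Fin n × Fin ℓ))) (k k' : Fin n) :
    Finset (Fin ℓ × Fin ℓ) :=
  Finset.univ.filter fun e => k < k' ∧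
    (((k, e.1), (k', e.2)) ∈ R ∨ ((k', e.2), (k, e.1)) ∈ R)

lemma card_le_sum_card_fiberPairs [NeZero n] (R : Finset ((Fin n × Fin ℓ) × (Fin n × Fin ℓ))) :
    R.card ≤ 2 * ∑ k ∈ Finset.univ.erase 0, ∑ k', (fiberPairs R k k').card + 3 * (n * ℓ ^ 2) := by
  have h1 : (R.filter fun r => r.1.1 ≠ 0 ∧ r.1.1 < r.2.1).card ≤
      ∑ k ∈ Finset.univ.erase 0, ∑ k', (fiberPairs R k k').card := by
    rw [← Finset.sum_product', Finset.card_eq_sum_card_fiberwise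
      (f := fun r => (r.1.1, r.2.1)) (t := Finset.univ.erase 0 ×ˢ Finset.univ) (by
        intro r hr
        have := (Finset.mem_filter.1 (Finset.mem_coe.1 hr)).2.1
        simpa using this)]
    refine Finset.sum_le_sum fun x _ => ?_
    refine Finset.card_le_card_of_injOn (fun r => (r.1.2, r.2.2)) ?_ ?_
    · rintro ⟨⟨k, a⟩, ⟨k', b⟩⟩ hr
      simp only [Finset.coe_filter, Finset.mem_filter, Set.mem_ofPred_eq] at hr
      obtain ⟨⟨hr, h0, hlt⟩, rfl⟩ := hr
      simp only [fiberPairs, Finset.coe_filter, Set.mem_ofPred_eq, Finset.mem_univ, true_and]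
      exact ⟨hlt, Or.inl hr⟩
    · rintro ⟨⟨k, a⟩, ⟨k', b⟩⟩ hr ⟨⟨l, a'⟩, ⟨l', b'⟩⟩ hr' h
      simp only [Finset.coe_filter, Finset.mem_filter, Set.mem_ofPred_eq, Prod.ext_iff]
        at hr hr' h ⊢
      exact ⟨⟨hr.2.1.trans hr'.2.1.symm, h.1⟩, hr.2.2.trans hr'.2.2.symm, h.2⟩
  have h2 : (R.filter fun r => r.2.1 ≠ 0 ∧ r.2.1 < r.1.1).card ≤
      ∑ k ∈ Finset.univ.erase 0, ∑ k', (fiberPairs R k k').card := by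
    rw [← Finset.sum_product', Finset.card_eq_sum_card_fiberwise
      (f := fun r => (r.2.1, r.1.1)) (t := Finset.univ.erase 0 ×ˢ Finset.univ) (by
        intro r hr
        have := (Finset.mem_filter.1 (Finset.mem_coe.1 hr)).2.1
        simpa using this)]
    refine Finset.sum_le_sum fun x _ => ?_
    refine Finset.card_le_card_of_injOn (fun r => (r.2.2, r.1.2)) ?_ ?_
    · rintro ⟨⟨k, a⟩, ⟨k', b⟩⟩ hr
      simp only [Finset.coe_filter, Finset.mem_filter, Set.mem_ofPred_eq] at hr
      obtain ⟨⟨hr, h0, hlt⟩, rfl⟩ := hr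
      simp only [fiberPairs, Finset.coe_filter, Set.mem_ofPred_eq, Finset.mem_univ, true_and]
      exact ⟨hlt, Or.inr hr⟩
    · rintro ⟨⟨k, a⟩, ⟨k', b⟩⟩ hr ⟨⟨l, a'⟩, ⟨l', b'⟩⟩ hr' h
      simp only [Finset.coe_filter, Finset.mem_filter, Set.mem_ofPred_eq, Prod.ext_iff]
        at hr hr' h ⊢
      exact ⟨⟨hr.2.2.trans hr'.2.2.symm, h.2⟩, hr.2.1.trans hr'.2.1.symm, h.1⟩
  have h3 : (R.filter fun r => r.1.1 = 0).card ≤ n * ℓ ^ 2 := by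
    calc _ ≤ (Finset.univ : Finset (Fin ℓ × (Fin n × Fin ℓ))).card := by
          refine Finset.card_le_card_of_injOn (fun r => (r.1.2, r.2))
            (fun _ _ => Finset.mem_coe.2 (Finset.mem_univ _)) ?_
          rintro ⟨⟨k, a⟩, y⟩ hr ⟨⟨l, a'⟩, y'⟩ hr' h
          simp only [Finset.coe_filter, Set.mem_ofPred_eq, Prod.mk.injEq] at hr hr' h ⊢
          exact ⟨⟨hr.2.trans hr'.2.symm, h.1⟩, h.2⟩
      _ = _ := by simp; ring
  have h4 : (R.filter fun r => r.2.1 = 0).card ≤ n * ℓ ^ 2 := by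
    calc _ ≤ (Finset.univ : Finset ((Fin n × Fin ℓ) × Fin ℓ)).card := by
          refine Finset.card_le_card_of_injOn (fun r => (r.1, r.2.2))
            (fun _ _ => Finset.mem_coe.2 (Finset.mem_univ _)) ?_
          rintro ⟨y, ⟨k, a⟩⟩ hr ⟨y', ⟨l, a'⟩⟩ hr' h
          simp only [Finset.coe_filter, Set.mem_ofPred_eq, Prod.mk.injEq] at hr hr' h ⊢
          exact ⟨h.1, hr.2.trans hr'.2.symm, h.2⟩
      _ = _ := by simp; ring
  have h5 : (R.filter fun r => r.1.1 = r.2.1).card ≤ n * ℓ ^ 2 := by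
    calc _ ≤ (Finset.univ : Finset ((Fin n × Fin ℓ) × Fin ℓ)).card := by
          refine Finset.card_le_card_of_injOn (fun r => (r.1, r.2.2))
            (fun _ _ => Finset.mem_coe.2 (Finset.mem_univ _)) ?_
          rintro ⟨⟨j, b⟩, ⟨k, a⟩⟩ hr ⟨⟨j', b'⟩, ⟨l, a'⟩⟩ hr' h
          simp only [Finset.coe_filter, Set.mem_ofPred_eq, Prod.mk.injEq] at hr hr' h ⊢
          exact ⟨h.1, hr.2.symm.trans (h.1.1.trans hr'.2), h.2⟩
      _ = _ := by simp; ring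
  have hR : R ⊆ (R.filter fun r => r.1.1 ≠ 0 ∧ r.1.1 < r.2.1) ∪
      ((R.filter fun r => r.2.1 ≠ 0 ∧ r.2.1 < r.1.1) ∪ ((R.filter fun r => r.1.1 = 0) ∪
      ((R.filter fun r => r.2.1 = 0) ∪ (R.filter fun r => r.1.1 = r.2.1)))) := by
    intro r hr
    simp only [Finset.mem_union, Finset.mem_filter, hr, true_and]
    rcases lt_trichotomy r.1.1 r.2.1 with h | h | h <;> tauto
  have h6 := (Finset.card_le_card hR).trans ((Finset.card_union_le _ _).trans
    (Nat.add_le_add_left ((Finset.card_union_le _ _).trans (Nat.add_le_add_left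
      ((Finset.card_union_le _ _).trans (Nat.add_le_add_left (Finset.card_union_le _ _) _)) _)) _))
  omega

lemma sq_mul_div_le_of_sq_le {ζ x y T Q : ℝ} (hζ : 0 ≤ ζ) (hx : 0 < x) (hy : 0 < y)
    (hT : ζ * x ^ 2 * y ^ 2 / 4 ≤ T) (hQ : T ^ 2 ≤ x ^ 2 * Q) :
    ζ ^ 2 * x ^ 2 * y / 256 ≤ Q / (16 * y ^ 3) := by
  have h5 : (ζ * x ^ 2 * y ^ 2 / 4) ^ 2 ≤ T ^ 2 := by gcongr
  have h7 : ζ ^ 2 * x ^ 2 * y / 256 * (16 * y ^ 3) = (ζ * x ^ 2 * y ^ 2 / 4) ^ 2 / x ^ 2 := by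
    field_simp; ring
  rw [le_div_iff₀ (by positivity), h7, div_le_iff₀ (by positivity)]
  linarith

/-- A union bound for the event that there is no edge in one of the sets `R ρ c` of pairs of
vertices. -/
lemma card_exists_no_adj_le [NeZero n] [NeZero ℓ] {ι : Type*} [DecidableEq ι] (I : Finset ι)
    (R : (Fin n → Perm (Fin ℓ)) → ι → Finset ((Fin n × Fin ℓ) × (Fin n × Fin ℓ))) {ζ : ℝ}
    (hζ : 0 ≤ ζ) (hn : 6 ≤ ζ * n) (hR : ∀ ρ, ∀ c ∈ I, ζ * n ^ 2 * ℓ ^ 2 ≤ ((R ρ c).card : ℝ))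
    (S : Finset (Fin n → Fin n → Perm (Fin ℓ)))
    (hS : ∀ σ ∈ S, ∃ c ∈ I, ∀ p ∈ R (σ 0) c, ¬ (liftGraph n ℓ σ).Adj p.1 p.2) :
    (S.card : ℝ) ≤ (I.card * Real.exp (-(ζ ^ 2 * n ^ 2 * ℓ / 256))) *
      Fintype.card (Fin n → Fin n → Perm (Fin ℓ)) := by
  have hn0 : (0 : ℝ) < n := Nat.cast_pos.2 (NeZero.pos n)
  have hℓ0 : (0 : ℝ) < ℓ := Nat.cast_pos.2 (NeZero.pos ℓ)
  rw [← nsmul_eq_mul, ← Finset.sum_const]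
  refine card_exists_forall_mem_le I
    (fun ρ c k k' => Finset.univ.filter fun π => ∀ a, (a, π a) ∉ fiberPairs (R ρ c) k k')
    (fun ρ c k k' => Real.exp (-(((fiberPairs (R ρ c) k k').card : ℝ) ^ 2 / (16 * (ℓ : ℝ) ^ 3)))) _
    ?_ ?_ S ?_
  · intro ρ c _ k k' _
    have := card_perm_avoid_le (fiberPairs (R ρ c) k k')
    rw [Fintype.card_fin] at this
    convert this using 3
    ext π
    simp only [Finset.mem_filter]
  · intro ρ c hc
    simp only [← Real.exp_sum]
    rw [Real.exp_le_exp]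
    simp only [Finset.sum_neg_distrib]
    rw [neg_le_neg_iff, ← Finset.sum_product']
    set P : Finset (Fin n × Fin n) := Finset.univ.erase 0 ×ˢ Finset.univ with hP
    set T : ℝ := ∑ x ∈ P, ((fiberPairs (R ρ c) x.1 x.2).card : ℝ) with hT
    have hT1 : ζ * n ^ 2 * ℓ ^ 2 / 4 ≤ T := by
      have h1 := card_le_sum_card_fiberPairs (R ρ c)
      rw [← Finset.sum_product', ← hP] at h1
      have h2 : ((R ρ c).card : ℝ) ≤ 2 * T + 3 * (n * ℓ ^ 2) := by
        rw [hT]; exact_mod_cast h1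
      have h3 := hR ρ c hc
      have h4 : 6 * (n * (ℓ : ℝ) ^ 2) ≤ ζ * n * (n * ℓ ^ 2) := by gcongr
      nlinarith
    have hPc : (P.card : ℝ) ≤ (n : ℝ) ^ 2 := by
      have h1 := Finset.card_le_univ P
      rw [Fintype.card_prod, Fintype.card_fin] at h1
      rw [sq]
      exact_mod_cast h1
    have hCS : T ^ 2 ≤ n ^ 2 * ∑ x ∈ P, ((fiberPairs (R ρ c) x.1 x.2).card : ℝ) ^ 2 :=
      sq_sum_le_card_mul_sum_sq.trans
        (mul_le_mul_of_nonneg_right hPc (Finset.sum_nonneg fun _ _ => sq_nonneg _))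
    rw [← Finset.sum_div]
    exact sq_mul_div_le_of_sq_le hζ hn0 hℓ0 hT1 hCS
  · intro σ hσ
    obtain ⟨c, hc, h⟩ := hS σ hσ
    refine ⟨c, hc, fun k k' _ => ?_⟩
    simp only [Finset.mem_filter, Finset.mem_univ, true_and, fiberPairs]
    rintro a ⟨hlt, hr⟩
    have hadj : (liftGraph n ℓ σ).Adj (k, a) (k', σ k k' a) := (liftGraph_adj_of_lt hlt).2 rfl
    rcases hr with hr | hr
    · exact h _ hr hadj
    · exact h _ hr hadj.symm

lemma card_not_isJoined_le [NeZero n] [NeZero ℓ] {m : ℕ} {κ : ℝ} (hκ : 0 ≤ κ)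
    (hn : 6 ≤ κ ^ 2 * n) (hm : κ * n * ℓ ≤ m) (S : Finset (Fin n → Fin n → Perm (Fin ℓ)))
    (hS : ∀ σ ∈ S, ¬ IsJoined (liftGraph n ℓ σ) m) :
    (S.card : ℝ) ≤ (4 ^ (n * ℓ) * Real.exp (-(κ ^ 4 * n ^ 2 * ℓ / 256))) *
      Fintype.card (Fin n → Fin n → Perm (Fin ℓ)) := by
  classical
  set I : Finset (Finset (Fin n × Fin ℓ) × Finset (Fin n × Fin ℓ)) :=
    Finset.univ.filter fun c => m ≤ c.1.card ∧ m ≤ c.2.card with hI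
  have h1 := card_exists_no_adj_le I (fun _ c => c.1 ×ˢ c.2) (sq_nonneg κ) hn (by
    intro _ c hc
    obtain ⟨h1, h2⟩ := (Finset.mem_filter.1 hc).2
    have h1' : κ * n * ℓ ≤ c.1.card := hm.trans (Nat.cast_le.2 h1)
    have h2' : κ * n * ℓ ≤ c.2.card := hm.trans (Nat.cast_le.2 h2)
    rw [Finset.card_product, Nat.cast_mul]
    calc κ ^ 2 * n ^ 2 * ℓ ^ 2 = (κ * n * ℓ) * (κ * n * ℓ) := by ring
      _ ≤ _ := mul_le_mul h1' h2' (mul_nonneg (mul_nonneg hκ (Nat.cast_nonneg _))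
          (Nat.cast_nonneg _)) (Nat.cast_nonneg _)) S (by
    intro σ hσ
    have := hS σ hσ
    unfold IsJoined at this
    push Not at this
    obtain ⟨A, B, hA, hB, h⟩ := this
    refine ⟨(A, B), by simp [hI, hA, hB], fun p hp => ?_⟩
    rw [Finset.mem_product] at hp
    exact h p.1 hp.1 p.2 hp.2)
  refine h1.trans (mul_le_mul_of_nonneg_right ?_ (Nat.cast_nonneg _))
  have hc : (I.card : ℝ) ≤ 4 ^ (n * ℓ) := by
    have h2 := Finset.card_le_univ I
    rw [Fintype.card_prod, Fintype.card_finset, Fintype.card_prod, Fintype.card_fin,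
      Fintype.card_fin, ← mul_pow] at h2
    exact_mod_cast h2
  rw [show (κ ^ 2) ^ 2 = κ ^ 4 by ring]
  exact mul_le_mul_of_nonneg_right hc (Real.exp_nonneg _)

lemma card_forall_le_undone_le [NeZero n] [NeZero ℓ] (hnℓ : n ≤ ℓ) {s ζ : ℝ} (hs : 0 ≤ s)
    (hζ : 0 ≤ ζ) (hn : 6 ≤ ζ * n) (h : ζ * n ^ 4 * ℓ ^ 2 ≤ s ^ 3)
    (S : Finset (Fin n → Fin n → Perm (Fin ℓ)))
    (hS : ∀ σ ∈ S, ∀ φ : Fin n → Perm (Fin n), (∀ i, φ i i = 0) →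
      s ≤ (undone σ hnℓ φ).card) :
    (S.card : ℝ) ≤ ((n.factorial : ℝ) ^ n * 2 ^ (n * n) *
      Real.exp (-(ζ ^ 2 * n ^ 2 * ℓ / 256))) * Fintype.card (Fin n → Fin n → Perm (Fin ℓ)) := by
  classical
  set I : Finset ((Fin n → Perm (Fin n)) × Finset (Fin n × Fin n)) :=
    Finset.univ.filter fun c => s ≤ c.2.card ∧ ∀ i j, (i, j) ∈ c.2 → (j, i) ∈ c.2 with hI
  have h1 := card_exists_no_adj_le I (fun ρ c => switchPairs ρ hnℓ c.1 c.2) hζ hn (by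
    intro ρ c hc
    obtain ⟨h1, h2⟩ := (Finset.mem_filter.1 hc).2
    have h3 := card_pow_three_le_card_switchPairs ρ hnℓ c.1 h2 (NeZero.pos n)
    have h4 : s ^ 3 ≤ (c.2.card : ℝ) ^ 3 := by gcongr
    have hn0 : (0 : ℝ) < n ^ 2 := pow_pos (Nat.cast_pos.2 (NeZero.pos n)) 2
    rw [← mul_le_mul_iff_right₀ hn0]
    linarith) S (by
    intro σ hσ
    obtain ⟨φ, hφ, hno⟩ := exists_no_adj_switchPairs σ hnℓ
    refine ⟨(φ, undone σ hnℓ φ), ?_, hno⟩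
    rw [hI, Finset.mem_filter]
    exact ⟨Finset.mem_univ _, hS σ hσ φ hφ, fun i j => undone_symm⟩)
  refine h1.trans (mul_le_mul_of_nonneg_right ?_ (Nat.cast_nonneg _))
  have hc : (I.card : ℝ) ≤ (n.factorial : ℝ) ^ n * 2 ^ (n * n) := by
    have h2 := Finset.card_le_univ I
    simp only [Fintype.card_prod, Fintype.card_finset, Fintype.card_pi, Fintype.card_perm,
      Fintype.card_fin, Finset.prod_const, Finset.card_univ] at h2
    exact_mod_cast h2
  exact mul_le_mul_of_nonneg_right hc (Real.exp_nonneg _)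

lemma prod_le_pow_card_of_sum_le {ι : Type*} {K : Finset ι} {x : ι → ℝ} {p : ℝ} (hp : 0 < p)
    (hx : ∀ k ∈ K, 0 ≤ x k) (h : ∑ k ∈ K, x k ≤ p * K.card) : ∏ k ∈ K, x k ≤ p ^ K.card := by
  calc ∏ k ∈ K, x k ≤ ∏ k ∈ K, (p * Real.exp (x k / p - 1)) := by
        refine Finset.prod_le_prod hx fun k _ => ?_
        have := Real.add_one_le_exp (x k / p - 1)
        rw [sub_add_cancel, div_le_iff₀ hp] at this
        linarith
    _ = p ^ K.card * Real.exp ((∑ k ∈ K, x k) / p - K.card) := by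
        rw [Finset.prod_mul_distrib, Finset.prod_const, ← Real.exp_sum, Finset.sum_sub_distrib,
          Finset.sum_div, Finset.sum_const, nsmul_eq_mul, mul_one]
    _ ≤ p ^ K.card * 1 := by
        gcongr
        rw [Real.exp_le_one_iff, sub_nonpos, div_le_iff₀ hp]
        linarith
    _ = _ := mul_one _

/-- The elements of the fiber of `k` that lie in `T`. -/
def slice (T : Finset (Fin n × Fin ℓ)) (k : Fin n) : Finset (Fin ℓ) :=
  Finset.univ.filter fun a => (k, a) ∈ T

lemma sum_card_slice_le (T : Finset (Fin n × Fin ℓ)) (K : Finset (Fin n)) :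
    ∑ k ∈ K, (slice T k).card ≤ T.card := by
  rw [← Finset.card_sigma]
  refine Finset.card_le_card_of_injOn (fun x => (x.1, x.2)) ?_ ?_
  · rintro ⟨k, a⟩ h
    exact (Finset.mem_filter.1 (Finset.mem_sigma.1 (Finset.mem_coe.1 h)).2).2
  · rintro ⟨k, a⟩ _ ⟨k', a'⟩ _ h
    simp only [Prod.mk.injEq] at h
    obtain ⟨rfl, rfl⟩ := h
    rfl

lemma card_le_sum_card_slice {T : Finset (Fin n × Fin ℓ)} {K : Finset (Fin n)}
    (h : ∀ x ∈ T, x.1 ∈ K) : T.card ≤ ∑ k ∈ K, (slice T k).card := by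
  rw [← Finset.card_sigma]
  refine Finset.card_le_card_of_injOn (fun x => ⟨x.1, x.2⟩) ?_ ?_
  · rintro ⟨k, a⟩ hx
    simpa [slice] using ⟨h _ hx, hx⟩
  · rintro ⟨k, a⟩ _ ⟨k', a'⟩ _ h
    simp only [Sigma.mk.injEq, heq_eq_eq] at h
    rw [h.1, h.2]

lemma prod_prod_ite_eq {L K : Finset (Fin n)} (hLK : Disjoint L K) (f : Fin n → Fin n → ℝ)
    {P : Finset (Fin n)} (hL : L ⊆ P) (hK : K ⊆ P) :
    ∏ k ∈ P, ∏ k', ((if k < k' ∧ k ∈ L ∧ k' ∈ K then f k k' else 1) *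
      (if k < k' ∧ k' ∈ L ∧ k ∈ K then f k' k else 1)) = ∏ q ∈ L, ∏ k ∈ K, f q k := by
  have h0 : ∏ k ∈ P, ∏ k', ((if k < k' ∧ k ∈ L ∧ k' ∈ K then f k k' else 1) *
      (if k < k' ∧ k' ∈ L ∧ k ∈ K then f k' k else 1)) =
      ∏ k, ∏ k', ((if k < k' ∧ k ∈ L ∧ k' ∈ K then f k k' else 1) *
      (if k < k' ∧ k' ∈ L ∧ k ∈ K then f k' k else 1)) := by
    refine Finset.prod_subset (Finset.subset_univ _) fun k _ hk => Finset.prod_eq_one fun k' _ => ?_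
    rw [if_neg (fun h => hk (hL h.2.1)), if_neg (fun h => hk (hK h.2.2)), one_mul]
  rw [h0]
  simp only [Finset.prod_mul_distrib]
  rw [Finset.prod_comm (f := fun k k' => if k < k' ∧ k' ∈ L ∧ k ∈ K then f k' k else 1),
    ← Finset.prod_mul_distrib]
  simp only [← Finset.prod_mul_distrib]
  rw [← Finset.prod_product', ← Finset.prod_product', Finset.univ_product_univ]
  symm
  refine Finset.prod_subset_one_on_sdiff (Finset.subset_univ _) ?_ ?_
  · rintro ⟨q, k⟩ h
    simp only [Finset.mem_sdiff, Finset.mem_product, Finset.mem_univ, true_and] at h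
    rw [if_neg (fun h' => h h'.2), if_neg (fun h' => h h'.2), one_mul]
  · rintro ⟨q, k⟩ h
    obtain ⟨h1, h2⟩ := Finset.mem_product.1 h
    dsimp only at h1 h2 ⊢
    rcases lt_trichotomy q k with h' | rfl | h'
    · rw [if_pos ⟨h', h1, h2⟩, if_neg (fun h'' => h'.asymm h''.1), mul_one]
    · exact absurd h2 (Finset.disjoint_left.1 hLK h1)
    · rw [if_neg (fun h'' => h'.asymm h''.1), if_pos ⟨h', h1, h2⟩, one_mul]

lemma card_perm_symm_mapsTo_le {α : Type*} [Fintype α] [DecidableEq α] {A C : Finset α}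
    {S : Finset (Perm α)} (hS : ∀ σ ∈ S, ∀ a ∈ A, σ.symm a ∈ C) :
    (S.card : ℝ) ≤ (C.card / Fintype.card α : ℝ) ^ A.card * (Fintype.card α).factorial := by
  rw [← Finset.card_image_of_injective S (inv_injective (G := Perm α))]
  refine card_perm_mapsTo_le fun σ hσ => ?_
  obtain ⟨τ, hτ, rfl⟩ := Finset.mem_image.1 hσ
  exact hS τ hτ

/-- The elements of the fiber of `k` that lie in `T` or are terminals. -/
def slotsOf (hnℓ : n ≤ ℓ) (ρ : Fin n → Perm (Fin ℓ)) (T : Finset (Fin n × Fin ℓ)) (k : Fin n) :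
    Finset (Fin ℓ) :=
  slice T k ∪ Finset.univ.image fun i => ρ k (Fin.castLE hnℓ i)

/-- The probability that some `u`-set in the fibers of `L` has few unused neighbours. -/
lemma card_exists_few_nbrs_le [NeZero n] [NeZero ℓ] (hnℓ : n ≤ ℓ) {L K : Finset (Fin n)}
    (hLK : Disjoint L K) (hL : 0 ∉ L) (hK : 0 ∉ K) {u : ℕ} (hu : 4 * u ≤ n * ℓ) {p : ℝ}
    (hp : 0 < p) (hpK : K.card * n + 4 * u ≤ p * K.card * ℓ)
    (S : Finset (Fin n → Fin n → Perm (Fin ℓ)))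
    (hS : ∀ σ ∈ S, ∃ U : Finset (Fin n × Fin ℓ), U.card = u ∧ (∀ x ∈ U, x.1 ∈ L) ∧
      (nbrs (liftGraph n ℓ σ) U \ usedVerts (σ 0) hnℓ).card ≤ 4 * u) :
    (S.card : ℝ) ≤ ((n * ℓ).choose u * (n * ℓ).choose (4 * u) * p ^ (K.card * u)) *
      Fintype.card (Fin n → Fin n → Perm (Fin ℓ)) := by
  classical
  have hℓ0 : (0 : ℝ) < ℓ := Nat.cast_pos.2 (NeZero.pos ℓ)
  set I : Finset (Finset (Fin n × Fin ℓ) × Finset (Fin n × Fin ℓ)) :=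
    (Finset.powersetCard u Finset.univ).filter (fun U => ∀ x ∈ U, x.1 ∈ L) ×ˢ
      Finset.powersetCard (4 * u) Finset.univ with hI
  have hIc : (I.card : ℝ) ≤ (n * ℓ).choose u * (n * ℓ).choose (4 * u) := by
    have h1 : I.card ≤ (n * ℓ).choose u * (n * ℓ).choose (4 * u) := by
      rw [hI, Finset.card_product, Finset.card_powersetCard, Finset.card_univ, Fintype.card_prod,
        Fintype.card_fin, Fintype.card_fin]
      refine Nat.mul_le_mul_right _ ((Finset.card_filter_le _ _).trans ?_)
      rw [Finset.card_powersetCard, Finset.card_univ, Fintype.card_prod,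
        Fintype.card_fin, Fintype.card_fin]
    exact_mod_cast h1
  have hnn : ∀ (C : Finset (Fin ℓ)) (j : ℕ), (0 : ℝ) ≤ (C.card / ℓ : ℝ) ^ j := fun C j =>
    pow_nonneg (div_nonneg (Nat.cast_nonneg _) (Nat.cast_nonneg _)) _
  have h1 := card_exists_forall_mem_le I
    (fun ρ c k k' => Finset.univ.filter fun π : Perm (Fin ℓ) =>
      ((k < k' ∧ k ∈ L ∧ k' ∈ K) → ∀ a ∈ slice c.1 k, π a ∈ slotsOf hnℓ ρ c.2 k') ∧
      ((k < k' ∧ k' ∈ L ∧ k ∈ K) → ∀ a ∈ slice c.1 k', π.symm a ∈ slotsOf hnℓ ρ c.2 k))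
    (fun ρ c k k' => (if k < k' ∧ k ∈ L ∧ k' ∈ K then
        ((slotsOf hnℓ ρ c.2 k').card / ℓ : ℝ) ^ (slice c.1 k).card else 1) *
      (if k < k' ∧ k' ∈ L ∧ k ∈ K then
        ((slotsOf hnℓ ρ c.2 k).card / ℓ : ℝ) ^ (slice c.1 k').card else 1))
    (fun _ => p ^ (K.card * u)) ?_ ?_ S ?_
  · rw [Finset.sum_const, nsmul_eq_mul] at h1
    refine h1.trans (mul_le_mul_of_nonneg_right ?_ (Nat.cast_nonneg _))
    exact mul_le_mul_of_nonneg_right hIc (pow_nonneg hp.le _)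
  · intro ρ c _ k k' _
    by_cases c1 : k < k' ∧ k ∈ L ∧ k' ∈ K
    · have c2 : ¬ (k < k' ∧ k' ∈ L ∧ k ∈ K) :=
        fun h => Finset.disjoint_left.1 hLK c1.2.1 h.2.2
      rw [if_pos c1, if_neg c2, mul_one]
      refine (card_perm_mapsTo_le (A := slice c.1 k) (C := slotsOf hnℓ ρ c.2 k')
        fun π hπ => (Finset.mem_filter.1 hπ).2.1 c1).trans (le_of_eq ?_)
      rw [Fintype.card_fin]
    · by_cases c2 : k < k' ∧ k' ∈ L ∧ k ∈ K
      · rw [if_neg c1, if_pos c2, one_mul]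
        refine (card_perm_symm_mapsTo_le (A := slice c.1 k') (C := slotsOf hnℓ ρ c.2 k)
          fun π hπ => (Finset.mem_filter.1 hπ).2.2 c2).trans (le_of_eq ?_)
        rw [Fintype.card_fin]
      · rw [if_neg c1, if_neg c2, one_mul, one_mul]
        have h2 := Finset.card_le_univ (Finset.univ.filter fun π : Perm (Fin ℓ) =>
          ((k < k' ∧ k ∈ L ∧ k' ∈ K) → ∀ a ∈ slice c.1 k, π a ∈ slotsOf hnℓ ρ c.2 k') ∧
          ((k < k' ∧ k' ∈ L ∧ k ∈ K) → ∀ a ∈ slice c.1 k', π.symm a ∈ slotsOf hnℓ ρ c.2 k))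
        rw [Fintype.card_perm, Fintype.card_fin] at h2
        exact Nat.cast_le.2 h2
  · intro ρ c hc
    obtain ⟨hU, hT⟩ := Finset.mem_product.1 hc
    obtain ⟨hU, hUL⟩ := Finset.mem_filter.1 hU
    have hUc := (Finset.mem_powersetCard.1 hU).2
    have hTc := (Finset.mem_powersetCard.1 hT).2
    rw [prod_prod_ite_eq (P := Finset.univ.erase 0) hLK
      (fun q k => ((slotsOf hnℓ ρ c.2 k).card / ℓ : ℝ) ^ (slice c.1 q).card)
      (fun q hq => Finset.mem_erase.2 ⟨fun h => hL (h ▸ hq), Finset.mem_univ _⟩)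
      (fun q hq => Finset.mem_erase.2 ⟨fun h => hK (h ▸ hq), Finset.mem_univ _⟩), Finset.prod_comm]
    simp only [Finset.prod_pow_eq_pow_sum]
    have hsum : ∑ q ∈ L, (slice c.1 q).card = u :=
      le_antisymm (hUc ▸ sum_card_slice_le _ _) (hUc ▸ card_le_sum_card_slice hUL)
    rw [hsum, Finset.prod_pow, pow_mul]
    refine pow_le_pow_left₀ (Finset.prod_nonneg fun k _ =>
      div_nonneg (Nat.cast_nonneg _) (Nat.cast_nonneg _)) ?_ _
    refine prod_le_pow_card_of_sum_le hp (fun k _ =>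
      div_nonneg (Nat.cast_nonneg _) (Nat.cast_nonneg _)) ?_
    rw [← Finset.sum_div, div_le_iff₀ hℓ0]
    refine le_trans ?_ hpK
    have h2 : ∑ k ∈ K, (slotsOf hnℓ ρ c.2 k).card ≤ K.card * n + 4 * u := by
      calc _ ≤ ∑ k ∈ K, ((slice c.2 k).card + n) := by
            refine Finset.sum_le_sum fun k _ => (Finset.card_union_le _ _).trans ?_
            refine Nat.add_le_add_left (Finset.card_image_le.trans ?_) _
            rw [Finset.card_univ, Fintype.card_fin]
        _ ≤ _ := by
            rw [Finset.sum_add_distrib, Finset.sum_const, smul_eq_mul, add_comm]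
            exact Nat.add_le_add_left (hTc ▸ sum_card_slice_le _ _) _
    exact_mod_cast h2
  · intro σ hσ
    obtain ⟨U, hUc, hUL, hN⟩ := hS σ hσ
    obtain ⟨T, hT, hTc⟩ := Finset.exists_superset_card_eq hN
      (by rw [Fintype.card_prod, Fintype.card_fin, Fintype.card_fin]; exact hu)
    have key : ∀ x ∈ U, ∀ y : Fin n × Fin ℓ, y.1 ∈ K → (liftGraph n ℓ σ).Adj x y →
        y.2 ∈ slotsOf hnℓ (σ 0) T y.1 := by
      rintro x hx ⟨k, b⟩ hk hadj
      rw [slotsOf, Finset.mem_union]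
      by_cases hW : (k, b) ∈ usedVerts (σ 0) hnℓ
      · right
        obtain h0 | ⟨i, hi⟩ := (Finset.mem_filter.1 hW).2
        · exact absurd hk (by rw [h0]; exact hK)
        · exact Finset.mem_image.2 ⟨i, Finset.mem_univ _, (Prod.ext_iff.1 hi).2.symm⟩
      · left
        rw [slice, Finset.mem_filter]
        exact ⟨Finset.mem_univ _, hT (Finset.mem_sdiff.2 ⟨mem_nbrs.2 ⟨x, hx, hadj⟩, hW⟩)⟩
    refine ⟨(U, T), ?_, fun k k' _ => ?_⟩
    · simp only [hI, Finset.mem_product, Finset.mem_filter, Finset.mem_powersetCard]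
      exact ⟨⟨⟨Finset.subset_univ _, hUc⟩, hUL⟩, Finset.subset_univ _, hTc⟩
    · refine Finset.mem_filter.2 ⟨Finset.mem_univ _, ?_, ?_⟩
      · rintro ⟨hlt, hkL, hkK⟩ a ha
        exact key (k, a) (Finset.mem_filter.1 ha).2 (k', σ k k' a) hkK
          ((liftGraph_adj_of_lt hlt).2 rfl)
      · rintro ⟨hlt, hkL, hkK⟩ a ha
        refine key (k', a) (Finset.mem_filter.1 ha).2 (k, (σ k k').symm a) hkK
          (SimpleGraph.Adj.symm ((liftGraph_adj_of_lt hlt).2 ?_))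
        exact (σ k k').apply_symm_apply a

lemma choose_le_exp_mul_div_pow (N : ℕ) {k : ℕ} (hk : 0 < k) :
    (N.choose k : ℝ) ≤ (Real.exp 1 * N / k) ^ k := by
  have hk0 : (0 : ℝ) < k := Nat.cast_pos.2 hk
  have h1 := Real.pow_div_factorial_le_exp (k : ℝ) hk0.le k
  have h2 : (N.choose k : ℝ) ≤ (N : ℝ) ^ k / k.factorial := Nat.choose_le_pow_div k N
  calc (N.choose k : ℝ) ≤ (N : ℝ) ^ k / k.factorial := h2
    _ = (N / k : ℝ) ^ k * ((k : ℝ) ^ k / k.factorial) := by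
        rw [div_pow]; field_simp
    _ ≤ (N / k : ℝ) ^ k * Real.exp k := by gcongr
    _ = _ := by
        rw [mul_div_assoc, mul_pow, ← Real.exp_nat_mul, mul_one, mul_comm]

lemma choose_mul_choose_le {N u : ℕ} (hu : 0 < u) :
    (N.choose u * N.choose (4 * u) : ℝ) ≤ (3 * (N / u : ℝ) ^ 5) ^ u := by
  have hu0 : (0 : ℝ) < u := Nat.cast_pos.2 hu
  have he : Real.exp 1 ≤ 3 := by linarith [Real.exp_one_lt_d9]
  have h1 : (N.choose u : ℝ) ≤ (3 * (N / u : ℝ)) ^ u := by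
    refine (choose_le_exp_mul_div_pow N hu).trans ?_
    rw [mul_div_assoc]
    gcongr
  have h2 : (N.choose (4 * u) : ℝ) ≤ ((N / u : ℝ) ^ 4) ^ u := by
    refine (choose_le_exp_mul_div_pow N (by positivity)).trans ?_
    rw [← pow_mul]
    refine pow_le_pow_left₀ (by positivity) ?_ _
    push_cast
    rw [div_le_div_iff₀ (by positivity) hu0]
    nlinarith [mul_nonneg (Nat.cast_nonneg N : (0 : ℝ) ≤ N) hu0.le]
  calc (N.choose u * N.choose (4 * u) : ℝ) ≤ (3 * (N / u : ℝ)) ^ u * ((N / u : ℝ) ^ 4) ^ u := by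
        gcongr
    _ = _ := by rw [← mul_pow]; congr 1; ring

lemma sum_Icc_pow_le {x : ℝ} (hx : 0 ≤ x) (hx' : x ≤ 1 / 2) (r : ℕ) :
    ∑ u ∈ Finset.Icc 1 r, x ^ u ≤ 2 * x := by
  have h : ∑ u ∈ Finset.Icc 1 r, x ^ u ≤ 2 * x * (1 - (1 / 2) ^ r) := by
    induction r with
    | zero => simp
    | succ r ih =>
      rw [Finset.sum_Icc_succ_top (by omega)]
      have h1 : x ^ (r + 1) ≤ x * (1 / 2) ^ r := by
        rw [pow_succ, mul_comm]
        gcongr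
      rw [pow_succ (1 / 2 : ℝ)]
      linarith
  refine h.trans ?_
  have : (0 : ℝ) ≤ (1 / 2) ^ r := by positivity
  nlinarith

/-- The probability that some small set outside the fiber of `0` has few unused neighbours. -/
lemma card_not_expanding_le [NeZero n] [NeZero ℓ] (hnℓ : n ≤ ℓ) (hn : 3 ≤ n) {m : ℕ} {x : ℝ}
    (hx : 0 ≤ x) (hx' : x ≤ 1 / 2) (hm : 8 * m ≤ n * ℓ)
    (hp : (n / ℓ + 8 * m / ((n / 3 : ℕ) * ℓ) : ℝ) ≤ 1)
    (h : ∀ u : ℕ, 1 ≤ u → u ≤ 2 * m →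
      3 * ((n * ℓ : ℕ) / u : ℝ) ^ 5 * (n / ℓ + 4 * u / ((n / 3 : ℕ) * ℓ) : ℝ) ^ (n / 3) ≤ x)
    (S : Finset (Fin n → Fin n → Perm (Fin ℓ)))
    (hS : ∀ σ ∈ S, ∃ U : Finset (Fin n × Fin ℓ), (∀ v ∈ U, v.1 ≠ 0) ∧ U.card ≤ 2 * m ∧
      (nbrs (liftGraph n ℓ σ) U \ usedVerts (σ 0) hnℓ).card < 2 * U.card) :
    (S.card : ℝ) ≤ (4 * x) * Fintype.card (Fin n → Fin n → Perm (Fin ℓ)) := by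
  classical
  have hℓ0 : (0 : ℝ) < ℓ := Nat.cast_pos.2 (NeZero.pos ℓ)
  have hn0 : (0 : ℝ) < n := Nat.cast_pos.2 (NeZero.pos n)
  have hf1 : 1 ≤ n / 3 := by omega
  have hf0 : (0 : ℝ) < (n / 3 : ℕ) := Nat.cast_pos.2 hf1
  set f := n / 3 with hf
  set Lo : Finset (Fin n) := Finset.univ.filter fun k => k ≠ 0 ∧ 2 * k.val < n with hLo
  set Hi : Finset (Fin n) := Finset.univ.filter fun k => ¬ 2 * k.val < n with hHi
  have hLoHi : Disjoint Lo Hi := by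
    rw [Finset.disjoint_left]
    intro k h1 h2
    exact (Finset.mem_filter.1 h2).2 (Finset.mem_filter.1 h1).2.2
  have hLo0 : 0 ∉ Lo := by simp [hLo]
  have hHi0 : 0 ∉ Hi := by simp [hHi, NeZero.ne n]
  have hLoc : f ≤ Lo.card := by
    calc f = (Finset.univ : Finset (Fin f)).card := by simp
      _ ≤ _ := by
        refine Finset.card_le_card_of_injOn (fun j => ⟨j.val + 1, by omega⟩) ?_ ?_
        · intro j _
          simp only [hLo, Finset.coe_filter, Set.mem_ofPred_eq, Finset.mem_univ, true_and]
          exact ⟨fun h => by simpa using congrArg Fin.val h, by omega⟩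
        · intro i _ j _ hij
          simp only [Fin.mk.injEq] at hij
          exact Fin.ext (by omega)
  have hHic : f ≤ Hi.card := by
    calc f = (Finset.univ : Finset (Fin f)).card := by simp
      _ ≤ _ := by
        refine Finset.card_le_card_of_injOn (fun j => ⟨n - 1 - j.val, by omega⟩) ?_ ?_
        · intro j _
          simp only [hHi, Finset.coe_filter, Set.mem_ofPred_eq, Finset.mem_univ, true_and]
          omega
        · intro i _ j _ hij
          simp only [Fin.mk.injEq] at hij
          exact Fin.ext (by omega)
  set Bad : Finset (Fin n) → ℕ → Finset (Fin n → Fin n → Perm (Fin ℓ)) := fun L u =>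
    Finset.univ.filter fun σ => ∃ U : Finset (Fin n × Fin ℓ), U.card = u ∧ (∀ x ∈ U, x.1 ∈ L) ∧
      (nbrs (liftGraph n ℓ σ) U \ usedVerts (σ 0) hnℓ).card ≤ 4 * u with hBad
  have hB : ∀ L K : Finset (Fin n), Disjoint L K → 0 ∉ L → 0 ∉ K → f ≤ K.card →
      ∀ u ∈ Finset.Icc 1 (2 * m), ((Bad L u).card : ℝ) ≤
        x ^ u * Fintype.card (Fin n → Fin n → Perm (Fin ℓ)) := by
    intro L K hLK hL hK hKc u hu
    obtain ⟨hu1, hu2⟩ := Finset.mem_Icc.1 hu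
    have hu0 : (0 : ℝ) < u := Nat.cast_pos.2 hu1
    set p : ℝ := n / ℓ + 4 * u / (f * ℓ) with hpdef
    have hp0 : 0 < p := by positivity
    have hp1 : p ≤ 1 := by
      refine le_trans ?_ hp
      have h4 : (4 * u : ℝ) ≤ 8 * m := by
        have : (u : ℝ) ≤ (2 * m : ℕ) := Nat.cast_le.2 hu2
        push_cast at this
        linarith
      have h5 := div_le_div_of_nonneg_right h4 (by positivity : (0 : ℝ) ≤ f * ℓ)
      linarith
    have hKf : (f : ℝ) ≤ K.card := Nat.cast_le.2 hKc
    refine (card_exists_few_nbrs_le hnℓ hLK hL hK (u := u) (by omega) hp0 ?_ (Bad L u)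
      fun σ hσ => (Finset.mem_filter.1 hσ).2).trans
      (mul_le_mul_of_nonneg_right ?_ (Nat.cast_nonneg _))
    · have h1 : p * K.card * ℓ = K.card * n + 4 * u * (K.card / f) := by
        rw [hpdef]; field_simp
      have h2 : (1 : ℝ) ≤ K.card / f := by rwa [one_le_div hf0]
      rw [h1]
      nlinarith
    · calc _ ≤ (3 * ((n * ℓ : ℕ) / u : ℝ) ^ 5) ^ u * p ^ (f * u) := by
            refine mul_le_mul (choose_mul_choose_le hu1) ?_ (pow_nonneg hp0.le _) (by positivity)
            exact pow_le_pow_of_le_one hp0.le hp1 (Nat.mul_le_mul_right _ hKc)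
        _ = (3 * ((n * ℓ : ℕ) / u : ℝ) ^ 5 * p ^ f) ^ u := by rw [pow_mul, ← mul_pow]
        _ ≤ x ^ u := by
            refine pow_le_pow_left₀ (by positivity) (h u hu1 hu2) _
  have hsub : S ⊆ (Finset.Icc 1 (2 * m)).biUnion fun u => Bad Lo u ∪ Bad Hi u := by
    intro σ hσ
    obtain ⟨U, hU0, hUm, hN⟩ := hS σ hσ
    have hsplit := Finset.card_filter_add_card_filter_not (s := U) (fun v => v.1 ∈ Lo)
    have hmono : ∀ U' ⊆ U, (nbrs (liftGraph n ℓ σ) U' \ usedVerts (σ 0) hnℓ).card ≤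
        (nbrs (liftGraph n ℓ σ) U \ usedVerts (σ 0) hnℓ).card := fun U' hU' =>
      Finset.card_le_card (Finset.sdiff_subset_sdiff (nbrs_mono hU') subset_rfl)
    simp only [Finset.mem_biUnion, Finset.mem_union]
    rcases le_total (U.filter fun v => ¬ v.1 ∈ Lo).card (U.filter fun v => v.1 ∈ Lo).card with
      hle | hle
    · have h1 := hmono _ (Finset.filter_subset (fun v => v.1 ∈ Lo) U)
      refine ⟨_, Finset.mem_Icc.2 ⟨?_, ?_⟩, Or.inl (Finset.mem_filter.2 ⟨Finset.mem_univ _,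
        U.filter fun v => v.1 ∈ Lo, rfl, fun v hv => (Finset.mem_filter.1 hv).2, ?_⟩)⟩ <;> omega
    · have h1 := hmono _ (Finset.filter_subset (fun v => ¬ v.1 ∈ Lo) U)
      refine ⟨_, Finset.mem_Icc.2 ⟨?_, ?_⟩, Or.inr (Finset.mem_filter.2 ⟨Finset.mem_univ _,
        U.filter fun v => ¬ v.1 ∈ Lo, rfl, fun v hv => ?_, ?_⟩)⟩
      · omega
      · omega
      · obtain ⟨hvU, hv⟩ := Finset.mem_filter.1 hv
        have h0 := hU0 v hvU
        simp only [hLo, hHi, Finset.mem_filter, Finset.mem_univ, true_and] at hv ⊢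
        tauto
      · omega
  have h1 : (S.card : ℝ) ≤
      ∑ u ∈ Finset.Icc 1 (2 * m), (((Bad Lo u).card : ℝ) + (Bad Hi u).card) := by
    exact_mod_cast (Finset.card_le_card hsub).trans (Finset.card_biUnion_le.trans
      (Finset.sum_le_sum fun u _ => Finset.card_union_le _ _))
  refine h1.trans ((Finset.sum_le_sum fun u hu => add_le_add (hB Lo Hi hLoHi hLo0 hHi0 hHic u hu)
    (hB Hi Lo hLoHi.symm hHi0 hLo0 hLoc u hu)).trans ?_)
  rw [Finset.sum_add_distrib, ← Finset.sum_mul, ← add_mul]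
  refine mul_le_mul_of_nonneg_right ?_ (Nat.cast_nonneg _)
  linarith [sum_Icc_pow_le hx hx' (2 * m)]

lemma card_usedVerts_le [NeZero n] (ρ : Fin n → Perm (Fin ℓ)) (hn : n ≤ ℓ) :
    (usedVerts ρ hn).card ≤ ℓ + n ^ 2 := by
  classical
  have hsub : usedVerts ρ hn ⊆ (Finset.univ.image fun a : Fin ℓ => ((0 : Fin n), a)) ∪
      Finset.univ.image fun e : Fin n × Fin n => terminal ρ hn e.1 e.2 := by
    intro v hv
    obtain h0 | ⟨i, hi⟩ := (Finset.mem_filter.1 hv).2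
    · exact Finset.mem_union_left _ (Finset.mem_image.2 ⟨v.2, Finset.mem_univ _, by rw [← h0]⟩)
    · exact Finset.mem_union_right _
        (Finset.mem_image.2 ⟨(v.1, i), Finset.mem_univ _, hi.symm⟩)
  refine (Finset.card_le_card hsub).trans ((Finset.card_union_le _ _).trans (Nat.add_le_add
    (Finset.card_image_le.trans ?_) (Finset.card_image_le.trans ?_)))
  · simp
  · simp [sq]

open Classical in
/-- Reduction to three unlikely events. -/
lemma one_sub_le_liftProb [NeZero n] [NeZero ℓ] (hnℓ : n ≤ ℓ) {m h : ℕ} {t a b c : ℝ} (hm : 1 ≤ m)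
    (hh : m < 2 ^ h) (hcard : ℓ + n ^ 2 + 7 * m + 2 * h * t ≤ (n * ℓ : ℝ))
    (ha : ((Finset.univ.filter fun σ : Fin n → Fin n → Perm (Fin ℓ) =>
      ∀ φ : Fin n → Perm (Fin n), (∀ i, φ i i = 0) → t ≤ (undone σ hnℓ φ).card).card : ℝ) ≤
      a * Fintype.card (Fin n → Fin n → Perm (Fin ℓ)))
    (hb : ((Finset.univ.filter fun σ : Fin n → Fin n → Perm (Fin ℓ) =>
      ∃ U : Finset (Fin n × Fin ℓ), (∀ v ∈ U, v.1 ≠ 0) ∧ U.card ≤ 2 * m ∧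
      (nbrs (liftGraph n ℓ σ) U \ usedVerts (σ 0) hnℓ).card < 2 * U.card).card : ℝ) ≤
      b * Fintype.card (Fin n → Fin n → Perm (Fin ℓ)))
    (hc : ((Finset.univ.filter fun σ : Fin n → Fin n → Perm (Fin ℓ) =>
      ¬ IsJoined (liftGraph n ℓ σ) m).card : ℝ) ≤
      c * Fintype.card (Fin n → Fin n → Perm (Fin ℓ))) :
    1 - (a + b + c) ≤ liftProb n ℓ fun G => HasTopClique G n := by
  set M : ℝ := (Fintype.card (Fin n → Fin n → Perm (Fin ℓ)) : ℝ) with hM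
  have hM0 : 0 < M := Nat.cast_pos.2 Fintype.card_pos
  set A := Finset.univ.filter fun σ : Fin n → Fin n → Perm (Fin ℓ) =>
      ∀ φ : Fin n → Perm (Fin n), (∀ i, φ i i = 0) → t ≤ (undone σ hnℓ φ).card with hA
  set B := Finset.univ.filter fun σ : Fin n → Fin n → Perm (Fin ℓ) =>
      ∃ U : Finset (Fin n × Fin ℓ), (∀ v ∈ U, v.1 ≠ 0) ∧ U.card ≤ 2 * m ∧
      (nbrs (liftGraph n ℓ σ) U \ usedVerts (σ 0) hnℓ).card < 2 * U.card with hB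
  set C := Finset.univ.filter fun σ : Fin n → Fin n → Perm (Fin ℓ) =>
      ¬ IsJoined (liftGraph n ℓ σ) m with hC
  have hsub : Finset.univ ⊆ (Finset.univ.filter fun σ : Fin n → Fin n → Perm (Fin ℓ) =>
      HasTopClique (liftGraph n ℓ σ) n) ∪ (A ∪ (B ∪ C)) := by
    intro σ _
    by_contra hσ
    simp only [Finset.mem_union, not_or, hA, hB, hC, Finset.mem_filter, Finset.mem_univ, true_and,
      not_not] at hσ
    obtain ⟨h1, h2, h3, h4⟩ := hσ
    push Not at h2 h3
    obtain ⟨φ, hφ, hlt⟩ := h2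
    refine h1 (hasTopClique_of_undone hnℓ h4 hm hh φ hφ h3 ?_)
    have h5 : ((usedVerts (σ 0) hnℓ).card : ℝ) ≤ ℓ + n ^ 2 := by
      exact_mod_cast card_usedVerts_le (σ 0) hnℓ
    have h6 : 2 * (h : ℝ) * (undone σ hnℓ φ).card ≤ 2 * h * t :=
      mul_le_mul_of_nonneg_left hlt.le (mul_nonneg zero_le_two (Nat.cast_nonneg _))
    have h7 : ((usedVerts (σ 0) hnℓ).card : ℝ) + 7 * m + 2 * h * (undone σ hnℓ φ).card ≤ n * ℓ := by
      linarith
    exact_mod_cast h7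
  have h1 := (Finset.card_le_card hsub).trans ((Finset.card_union_le _ _).trans
    (Nat.add_le_add_left ((Finset.card_union_le _ _).trans
      (Nat.add_le_add_left (Finset.card_union_le _ _) _)) _))
  rw [Finset.card_univ] at h1
  have h2 : M ≤ ((Finset.univ.filter fun σ : Fin n → Fin n → Perm (Fin ℓ) =>
      HasTopClique (liftGraph n ℓ σ) n).card : ℝ) + (A.card + (B.card + C.card)) := by
    rw [hM]; exact_mod_cast h1
  rw [liftProb, le_div_iff₀ hM0]
  have h3 : (1 - (a + b + c)) * M ≤ ((Finset.univ.filter fun σ : Fin n → Fin n → Perm (Fin ℓ) =>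
      HasTopClique (liftGraph n ℓ σ) n).card : ℝ) := by linarith
  convert h3

end RandomLifts

section Estimates

lemma expansion_estimate {n f : ℕ} {N y p q x : ℝ} (hn : 48 ≤ n) (hf : n ≤ 4 * f) (hp : 0 ≤ p)
    (hpq : p ≤ q) (hpy : p ≤ (n : ℝ) ^ 2 / N + 16 / y) (hy : 1 ≤ y) (hyN : y ≤ N) (hx : 3 ≤ x * n)
    (hq1 : q ≤ 1) (hq : 3 * (n : ℝ) ^ 25 * q ^ f ≤ x) : 3 * y ^ 5 * p ^ f ≤ x := by
  have hn' : (48 : ℝ) ≤ n := by exact_mod_cast hn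
  rcases le_total y ((n : ℝ) ^ 5) with h | h
  · refine le_trans ?_ hq
    have h1 : y ^ 5 ≤ (n : ℝ) ^ 25 := by
      calc y ^ 5 ≤ ((n : ℝ) ^ 5) ^ 5 := by gcongr
        _ = _ := by ring
    have h2 : p ^ f ≤ q ^ f := pow_le_pow_left₀ hp hpq f
    exact mul_le_mul (by linarith) h2 (pow_nonneg hp _) (by positivity)
  · have hy0 : 0 < y := by linarith
    have h1 : p ≤ 2 * n ^ 2 / y := by
      calc p ≤ (n : ℝ) ^ 2 / N + 16 / y := hpy
        _ ≤ (n : ℝ) ^ 2 / y + n ^ 2 / y := by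
            have h2 : (16 : ℝ) ≤ n ^ 2 := by nlinarith
            gcongr
        _ = _ := by ring
    have h2 : p ^ 2 ≤ 1 / y := by
      calc p ^ 2 ≤ (2 * n ^ 2 / y) ^ 2 := by gcongr
        _ = (4 * n ^ 4 / y) / y := by field_simp; ring
        _ ≤ 1 / y := by
            gcongr
            rw [div_le_one hy0]
            refine le_trans ?_ h
            have : (0 : ℝ) ≤ (n : ℝ) ^ 4 := by positivity
            nlinarith
    have h3 : p ^ f ≤ p ^ 12 := pow_le_pow_of_le_one hp (hpq.trans hq1) (by omega)
    have h4 : p ^ 12 ≤ (1 / y) ^ 6 := by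
      calc p ^ 12 = (p ^ 2) ^ 6 := by ring
        _ ≤ _ := by gcongr
    have hn5 : (n : ℝ) ≤ n ^ 5 := le_self_pow₀ (by linarith) (by norm_num)
    calc 3 * y ^ 5 * p ^ f ≤ 3 * y ^ 5 * (1 / y) ^ 6 := by gcongr; exact h3.trans h4
      _ = 3 / y := by field_simp
      _ ≤ 3 / n := by gcongr; exact hn5.trans h
      _ ≤ x := by rwa [div_le_iff₀ (by linarith)]

lemma joined_estimate {n ℓ : ℕ} {κ x : ℝ} (hℓ : 1 ≤ ℓ) (hn : 768 ≤ κ ^ 4 * n) (hx : 1 ≤ x * n)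
    (hn0 : 0 < n) :
    4 ^ (n * ℓ) * Real.exp (-(κ ^ 4 * n ^ 2 * ℓ / 256)) ≤ x := by
  have hn0' : (0 : ℝ) < n := by exact_mod_cast hn0
  have hℓ' : (1 : ℝ) ≤ ℓ := by exact_mod_cast hℓ
  have h4 : (4 : ℝ) ≤ Real.exp 2 := by
    have := Real.add_one_le_exp (1 : ℝ)
    calc (4 : ℝ) = (1 + 1) * (1 + 1) := by norm_num
      _ ≤ Real.exp 1 * Real.exp 1 := by gcongr
      _ = _ := by rw [← Real.exp_add]; norm_num
  calc (4 : ℝ) ^ (n * ℓ) * Real.exp (-(κ ^ 4 * n ^ 2 * ℓ / 256))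
      ≤ Real.exp 2 ^ (n * ℓ) * Real.exp (-(κ ^ 4 * n ^ 2 * ℓ / 256)) := by gcongr
    _ = Real.exp (2 * (n * ℓ) - κ ^ 4 * n ^ 2 * ℓ / 256) := by
        rw [← Real.exp_nat_mul, ← Real.exp_add]; push_cast; congr 1; ring
    _ ≤ Real.exp (-n) := by
        rw [Real.exp_le_exp]
        have h1 : 768 * (n * ℓ : ℝ) ≤ κ ^ 4 * n * (n * ℓ) := by gcongr
        have h2 : (n : ℝ) ≤ n * ℓ := le_mul_of_one_le_right hn0'.le hℓ'
        nlinarith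
    _ ≤ 1 / n := by
        rw [Real.exp_neg, ← one_div]
        gcongr
        linarith [Real.add_one_le_exp (n : ℝ)]
    _ ≤ x := by rwa [div_le_iff₀ hn0']

lemma switch_estimate {n ℓ : ℕ} {r x : ℝ} (hr : 3 ≤ r) (hrn : r ^ 20 = n) (hnℓ : n ≤ ℓ)
    (hlog : Real.log n ≤ r) (hx : 1 ≤ x * n) :
    (n.factorial : ℝ) ^ n * 2 ^ (n * n) * Real.exp (-((1 / r ^ 5) ^ 2 * n ^ 2 * ℓ / 256)) ≤ x := by
  have hn0 : (0 : ℝ) < n := by rw [← hrn]; positivity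
  have hn1 : (1 : ℝ) ≤ n := by
    rw [← hrn]; exact one_le_pow₀ (by linarith)
  have hnℓ' : (n : ℝ) ≤ ℓ := by exact_mod_cast hnℓ
  have h1 : (n.factorial : ℝ) ≤ Real.exp (n * Real.log n) := by
    rw [Real.exp_nat_mul, Real.exp_log hn0]
    exact_mod_cast Nat.factorial_le_pow n
  have h2 : (2 : ℝ) ≤ Real.exp 1 := by linarith [Real.add_one_le_exp (1 : ℝ)]
  have hr9 : 19683 * r ≤ r ^ 10 := by
    calc 19683 * r = 3 ^ 9 * r := by norm_num
      _ ≤ r ^ 9 * r := by gcongr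
      _ = _ := by ring
  calc _ ≤ Real.exp (n * Real.log n) ^ n * Real.exp 1 ^ (n * n) *
        Real.exp (-((1 / r ^ 5) ^ 2 * n ^ 2 * n / 256)) := by gcongr
    _ = Real.exp (n ^ 2 * (Real.log n + 1 - r ^ 10 / 256)) := by
        rw [← Real.exp_nat_mul, ← Real.exp_nat_mul, ← Real.exp_add, ← Real.exp_add]
        congr 1
        have h3 : (1 / r ^ 5) ^ 2 * (n : ℝ) ^ 2 * n = n ^ 2 * r ^ 10 := by
          nth_rw 2 [← hrn]
          field_simp
        rw [h3]; push_cast; ring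
    _ ≤ Real.exp (-n) := by
        rw [Real.exp_le_exp]
        have h4 : Real.log n + 1 - r ^ 10 / 256 ≤ -1 := by linarith
        nlinarith
    _ ≤ 1 / n := by
        rw [Real.exp_neg, ← one_div]
        gcongr
        linarith [Real.add_one_le_exp (n : ℝ)]
    _ ≤ x := by rwa [div_le_iff₀ hn0]

end Estimates

section RandomLifts

open Equiv

variable {n ℓ : ℕ}

lemma card_undone_le [NeZero n] (σ : Fin n → Fin n → Perm (Fin ℓ)) (hn : n ≤ ℓ)
    (φ : Fin n → Perm (Fin n)) : (undone σ hn φ).card ≤ n ^ 2 :=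
  (Finset.card_le_univ _).trans (by simp [sq])

lemma natLog_add_one_le {m N : ℕ} (hm : 1 ≤ m) (hmN : m ≤ N) :
    ((Nat.log 2 m + 1 : ℕ) : ℝ) ≤ 1 + 2 * Real.log N := by
  have h1 : ((2 : ℝ) ^ Nat.log 2 m) ≤ N := by
    exact_mod_cast (Nat.pow_log_le_self 2 (by omega)).trans hmN
  have h2 := Real.log_le_log (by positivity) h1
  rw [Real.log_pow] at h2
  have h3 : (Nat.log 2 m : ℝ) * (1 / 2) ≤ Nat.log 2 m * Real.log 2 :=
    mul_le_mul_of_nonneg_left (by linarith [Real.log_two_gt_d9]) (Nat.cast_nonneg _)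
  push_cast
  linarith

open Classical in
lemma exists_card_forall_le_undone_le [NeZero n] [NeZero ℓ] (hnℓ : n ≤ ℓ) {h : ℕ} {r η x : ℝ}
    (hη : 0 < η) (hr : 3 ≤ r) (hrn : r ^ 20 = n) (hlog : 16 + 64 * Real.log n ≤ η / 2 * r)
    (hlogr : Real.log n ≤ r) (hw : ∀ w, r ≤ w → 64 * Real.log w ≤ η / 2 * w)
    (hh : (h : ℝ) ≤ 1 + 2 * Real.log (n * ℓ : ℕ)) (hx : 1 ≤ x * n) :
    ∃ t : ℝ, 2 * h * t ≤ η / 4 * (n * ℓ) ∧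
      ((Finset.univ.filter fun σ : Fin n → Fin n → Perm (Fin ℓ) =>
        ∀ φ : Fin n → Perm (Fin n), (∀ i, φ i i = 0) → t ≤ (undone σ hnℓ φ).card).card : ℝ) ≤
      x * Fintype.card (Fin n → Fin n → Perm (Fin ℓ)) := by
  have hn0 : (0 : ℝ) < n := Nat.cast_pos.2 (NeZero.pos n)
  have hℓ0 : (0 : ℝ) < ℓ := Nat.cast_pos.2 (NeZero.pos ℓ)
  have hr0 : 0 < r := by linarith
  have hnℓ' : (n : ℝ) ≤ ℓ := Nat.cast_le.2 hnℓ
  have hx0 : 0 ≤ x := by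
    by_contra hx0
    nlinarith
  have hlogn : 0 ≤ Real.log n := Real.log_natCast_nonneg n
  rw [Nat.cast_mul, Real.log_mul hn0.ne' hℓ0.ne'] at hh
  rcases le_or_gt (ℓ : ℝ) (n * r) with hcase | hcase
  · refine ⟨n ^ 2 / r, ?_, ?_⟩
    · have hrn' : r ≤ n := by
        rw [← hrn]
        exact le_self_pow₀ (by linarith) (by norm_num)
      have h1 : Real.log ℓ ≤ 2 * Real.log n := by
        calc Real.log ℓ ≤ Real.log (n * n) := Real.log_le_log hℓ0 (hcase.trans (by gcongr))
          _ = _ := by rw [Real.log_mul hn0.ne' hn0.ne']; ring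
      have h2 : 8 * h ≤ η * r := by nlinarith
      calc 2 * h * (n ^ 2 / r) = 8 * h * (n ^ 2 / (4 * r)) := by field_simp; ring
        _ ≤ η * r * (n ^ 2 / (4 * r)) := by gcongr
        _ = η / 4 * (n * n) := by field_simp
        _ ≤ η / 4 * (n * ℓ) := by gcongr
    · refine (card_forall_le_undone_le hnℓ (s := n ^ 2 / r) (ζ := 1 / r ^ 5) (by positivity)
        (by positivity) ?_ ?_ _ fun σ hσ => (Finset.mem_filter.1 hσ).2).trans
        (mul_le_mul_of_nonneg_right (switch_estimate hr hrn hnℓ hlogr hx) (Nat.cast_nonneg _))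
      · rw [← hrn]
        calc (6 : ℝ) ≤ 3 ^ 15 := by norm_num
          _ ≤ r ^ 15 := by gcongr
          _ = 1 / r ^ 5 * r ^ 20 := by field_simp
      · calc 1 / r ^ 5 * (n : ℝ) ^ 4 * ℓ ^ 2 ≤ 1 / r ^ 5 * (n : ℝ) ^ 4 * (n * r) ^ 2 := by gcongr
          _ = (n ^ 2 / r) ^ 3 := by field_simp
  · refine ⟨2 * n ^ 2, ?_, ?_⟩
    · set w : ℝ := ℓ / n with hwdef
      have hℓw : (ℓ : ℝ) = n * w := by rw [hwdef]; field_simp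
      have hrw : r ≤ w := by
        rw [hwdef, le_div_iff₀ hn0]; linarith
      have hw0 : 0 < w := by linarith
      have h1 := hw w hrw
      rw [hℓw, Real.log_mul hn0.ne' hw0.ne'] at hh
      have h3 : η / 2 * r ≤ η / 2 * w := by gcongr
      have h2 : 16 * h ≤ η * w := by linarith [Real.log_nonneg (show 1 ≤ w by linarith)]
      calc 2 * (h : ℝ) * (2 * n ^ 2) = 16 * h * (n ^ 2 / 4) := by ring
        _ ≤ η * w * (n ^ 2 / 4) := by gcongr
        _ = η / 4 * (n * ℓ) := by rw [hℓw]; ring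
    · rw [Finset.filter_eq_empty_iff.2]
      · rw [Finset.card_empty, Nat.cast_zero]
        exact mul_nonneg hx0 (Nat.cast_nonneg _)
      · intro σ _ hσ
        have h1 := hσ (fun i => swap 0 i) fun i => swap_apply_right _ _
        have h2 : ((undone σ hnℓ fun i => swap 0 i).card : ℝ) ≤ n ^ 2 := by
          exact_mod_cast card_undone_le σ hnℓ _
        have h3 : (0 : ℝ) < n ^ 2 := pow_pos hn0 2
        linarith

lemma one_sub_le_liftProb_of_estimates {r η x : ℝ} (hη : 0 < η) (hη' : η ≤ 1 / 2)
    (hnℓ : (n : ℝ) ≤ (1 - η) * ℓ) (hn : 48 ≤ n) (hnη : 768 ≤ (η / 256) ^ 4 * n)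
    (hx' : x ≤ 1 / 2) (hx : 3 ≤ x * n) (hr : 3 ≤ r) (hrn : r ^ 20 = n)
    (hlog : 16 + 64 * Real.log n ≤ η / 2 * r) (hlogr : Real.log n ≤ r)
    (hw : ∀ w, r ≤ w → 64 * Real.log w ≤ η / 2 * w)
    (hq : 3 * (n : ℝ) ^ 25 * (1 - 3 * η / 4) ^ (n / 3) ≤ x) :
    1 - 6 * x ≤ liftProb n ℓ fun G => HasTopClique G n := by
  classical
  have hn0 : (0 : ℝ) < n := Nat.cast_pos.2 (by omega)
  have hℓ0 : (0 : ℝ) < ℓ := by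
    by_contra hℓ
    have : (ℓ : ℝ) = 0 := le_antisymm (not_lt.1 hℓ) (Nat.cast_nonneg _)
    rw [this] at hnℓ
    linarith
  have hnℓR : (n : ℝ) ≤ ℓ := by nlinarith
  have hnℓN : n ≤ ℓ := Nat.cast_le.1 hnℓR
  have : NeZero n := ⟨by omega⟩
  have : NeZero ℓ := ⟨by omega⟩
  have hx0 : 0 ≤ x := by
    by_contra hx0
    nlinarith
  set κ : ℝ := η / 256 with hκ
  have hκ0 : 0 < κ := by positivity
  have hκ1 : κ ≤ 1 := by linarith
  have hκn2 : 768 ≤ κ ^ 2 * n := hnη.trans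
    (mul_le_mul_of_nonneg_right (pow_le_pow_of_le_one hκ0.le hκ1 (by norm_num)) hn0.le)
  have hκn : 768 ≤ κ * n := hκn2.trans
    (mul_le_mul_of_nonneg_right (pow_le_of_le_one hκ0.le hκ1 two_ne_zero) hn0.le)
  have hℓ1 : (1 : ℝ) ≤ ℓ := by exact_mod_cast NeZero.pos ℓ
  have hκN : 768 ≤ κ * n * ℓ := by nlinarith
  set m := ⌈κ * n * ℓ⌉₊ with hm
  have hm1 : κ * n * ℓ ≤ m := Nat.le_ceil _
  have hm2 : (m : ℝ) ≤ 2 * (κ * n * ℓ) := by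
    have := Nat.ceil_lt_add_one (show 0 ≤ κ * n * ℓ by linarith)
    linarith
  have hN0 : (0 : ℝ) < n * ℓ := mul_pos hn0 hℓ0
  have hmN' : 128 * (m : ℝ) ≤ η * (n * ℓ) := by
    rw [show η = 256 * κ by rw [hκ]; ring]
    linarith
  have hmN : 8 * m ≤ n * ℓ := by
    have : 8 * (m : ℝ) ≤ n * ℓ := by nlinarith
    exact_mod_cast this
  have hm0 : 1 ≤ m := by
    have : (0 : ℝ) < m := by linarith
    exact_mod_cast this
  obtain ⟨t, ht, ha⟩ := exists_card_forall_le_undone_le hnℓN hη hr hrn hlog hlogr hw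
    (natLog_add_one_le hm0 (show m ≤ n * ℓ by omega)) (x := x) (by linarith)
  have hf : n ≤ 4 * (n / 3) := by omega
  have hf0 : (0 : ℝ) < (n / 3 : ℕ) := Nat.cast_pos.2 (by omega)
  have hf' : (n : ℝ) ≤ 4 * (n / 3 : ℕ) := by exact_mod_cast hf
  have hfrac : ∀ u : ℝ, 0 ≤ u → 4 * u / ((n / 3 : ℕ) * ℓ) ≤ 16 * u / (n * ℓ) := by
    intro u hu
    rw [div_le_div_iff₀ (mul_pos hf0 hℓ0) hN0]
    have : u * ℓ * n ≤ u * ℓ * (4 * (n / 3 : ℕ)) := by gcongr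
    linarith
  have hnℓ1 : (n / ℓ : ℝ) ≤ 1 - η := by rwa [div_le_iff₀ hℓ0]
  have hpq : ∀ u : ℝ, 0 ≤ u → u ≤ 2 * m →
      (n / ℓ + 4 * u / ((n / 3 : ℕ) * ℓ) : ℝ) ≤ 1 - 3 * η / 4 := by
    intro u hu hum
    have h1 : 16 * u / (n * ℓ) ≤ η / 4 := by
      rw [div_le_iff₀ hN0]
      linarith
    linarith [hfrac u hu]
  have hb := card_not_expanding_le hnℓN (by omega) hx0 hx' hmN (by
      have := hpq (2 * m) (by positivity) le_rfl
      rw [← mul_assoc] at this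
      norm_num at this
      linarith) (by
      intro u hu hum
      have hu' : (1 : ℝ) ≤ u := by exact_mod_cast hu
      have hum' : (u : ℝ) ≤ 2 * m := by exact_mod_cast hum
      have hu0 : (0 : ℝ) < u := by linarith
      refine expansion_estimate (N := (n * ℓ : ℕ)) hn hf (by positivity) (hpq u hu0.le hum') ?_ ?_
        ?_ hx (by linarith) hq
      · rw [Nat.cast_mul, div_div_eq_mul_div]
        refine add_le_add (le_of_eq (by field_simp)) (hfrac u hu0.le)
      · rw [one_le_div hu0]
        exact_mod_cast hum.trans (by omega : 2 * m ≤ n * ℓ)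
      · exact div_le_self (Nat.cast_nonneg _) hu')
    (Finset.univ.filter fun σ : Fin n → Fin n → Perm (Fin ℓ) =>
      ∃ U : Finset (Fin n × Fin ℓ), (∀ v ∈ U, v.1 ≠ 0) ∧ U.card ≤ 2 * m ∧
      (nbrs (liftGraph n ℓ σ) U \ usedVerts (σ 0) hnℓN).card < 2 * U.card)
    fun σ hσ => (Finset.mem_filter.1 hσ).2
  have hc := (card_not_isJoined_le hκ0.le (by linarith) hm1
    (Finset.univ.filter fun σ : Fin n → Fin n → Perm (Fin ℓ) => ¬ IsJoined (liftGraph n ℓ σ) m)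
    fun σ hσ => (Finset.mem_filter.1 hσ).2).trans (mul_le_mul_of_nonneg_right
      (joined_estimate (x := x) (NeZero.pos ℓ) hnη (by linarith) (NeZero.pos n))
      (Nat.cast_nonneg _))
  have h1 : (n : ℝ) ^ 2 ≤ (1 - η) * (n * ℓ) := by nlinarith only [hnℓ, hn0]
  have h2 : (ℓ : ℝ) ≤ η / 4 * (n * ℓ) := by
    have h4 : 1 ≤ η / 4 * n := by
      rw [show η = 256 * κ by rw [hκ]; ring]
      linarith only [hκn]
    nlinarith only [h4, hℓ0]
  have h3 : 7 * (m : ℝ) ≤ η / 4 * (n * ℓ) := by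
    have := mul_pos hη hN0
    linarith only [hmN', this]
  rw [show 1 - 6 * x = 1 - (x + 4 * x + x) by ring]
  refine one_sub_le_liftProb hnℓN hm0 (Nat.lt_pow_succ_log_self one_lt_two m) ?_ ha
    (by convert hb) (by convert hc)
  linarith only [h1, h2, h3, ht]

end RandomLifts

section Asymptotics

open Filter

lemma eventually_pow_mul_pow_div_three_le {q x : ℝ} (hq : 0 ≤ q) (hq' : q < 1) (hx : 0 < x) :
    ∀ᶠ n : ℕ in atTop, 3 * (n : ℝ) ^ 25 * q ^ (n / 3) ≤ x := by
  have h := (tendsto_pow_const_mul_const_pow_of_abs_lt_one 25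
    (by rwa [abs_of_nonneg hq] : |q| < 1)).comp (Nat.tendsto_div_const_atTop (n := 3) (by norm_num))
  have hc : 0 < x / (3 * 4 ^ 25) := by positivity
  filter_upwards [h.eventually_le_const hc, eventually_ge_atTop 48] with n h1 hn
  simp only [Function.comp_apply] at h1
  rw [le_div_iff₀ (by positivity)] at h1
  have h2 : (n : ℝ) ≤ 4 * (n / 3 : ℕ) := by exact_mod_cast (by omega : n ≤ 4 * (n / 3))
  refine le_trans ?_ h1
  calc 3 * (n : ℝ) ^ 25 * q ^ (n / 3) ≤ 3 * (4 * (n / 3 : ℕ)) ^ 25 * q ^ (n / 3) := by gcongr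
    _ = _ := by ring

lemma eventually_log_le_mul {c : ℝ} (hc : 0 < c) : ∀ᶠ w : ℝ in atTop, Real.log w ≤ c * w := by
  filter_upwards [Real.isLittleO_log_id_atTop.bound hc, eventually_ge_atTop 0] with w hw hw0
  simpa [abs_of_nonneg hw0] using (le_abs_self _).trans hw

lemma eventually_log_le_mul_rpow {c s : ℝ} (hc : 0 < c) (hs : 0 < s) :
    ∀ᶠ n : ℕ in atTop, Real.log n ≤ c * (n : ℝ) ^ s := by
  filter_upwards [tendsto_natCast_atTop_atTop.eventually ((isLittleO_log_rpow_atTop hs).bound hc)]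
    with n hn
  have h1 : (0 : ℝ) ≤ (n : ℝ) ^ s := by positivity
  rw [Real.norm_of_nonneg h1] at hn
  exact (le_abs_self _).trans hn

end Asymptotics

/-- For every `ε, δ > 0` there exists `N` such that for all `n ≥ N` and all integers
`ℓ ≥ (1+ε)n`, the proportion of `ℓ`-lifts of `K_n` containing a subdivision of `K_n`
is at least `1 - δ`. -/
theorem stmt0 (ε δ : ℝ) (hε : 0 < ε) (hδ : 0 < δ) :
    ∃ N : ℕ, ∀ n : ℕ, N ≤ n → ∀ ℓ : ℕ, (1 + ε) * n ≤ (ℓ : ℝ) →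
      1 - δ ≤ liftProb n ℓ (fun G => HasTopClique G n) := by
  set η : ℝ := min ε 1 / 2 with hη
  have hη0 : 0 < η := by positivity
  have hη1 : η ≤ 1 / 2 := by linarith [min_le_right ε 1]
  have hηε : 2 * η ≤ ε := by linarith [min_le_left ε 1]
  set x : ℝ := min (δ / 6) (1 / 2) with hx
  have hx0 : 0 < x := by positivity
  have hxδ : 6 * x ≤ δ := by linarith [min_le_left (δ / 6) (1 / 2)]
  have hcast : ∀ c : ℝ, ∀ᶠ n : ℕ in Filter.atTop, c ≤ n := fun c =>
    tendsto_natCast_atTop_atTop.eventually_ge_atTop c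
  have hroot : Filter.Tendsto (fun n : ℕ => (n : ℝ) ^ (1 / 20 : ℝ)) Filter.atTop Filter.atTop :=
    (tendsto_rpow_atTop (by norm_num)).comp tendsto_natCast_atTop_atTop
  obtain ⟨w₀, hw₀⟩ := Filter.eventually_atTop.1
    (eventually_log_le_mul (show 0 < η / 128 by positivity))
  refine Filter.eventually_atTop.1 ?_
  filter_upwards [Filter.eventually_ge_atTop 48, hcast (768 / (η / 256) ^ 4), hcast (3 / x),
    hroot.eventually_ge_atTop 3, hroot.eventually_ge_atTop w₀, hroot.eventually_ge_atTop (64 / η),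
    eventually_log_le_mul_rpow (s := 1 / 20) (show 0 < η / 256 by positivity) (by norm_num),
    eventually_log_le_mul_rpow (s := 1 / 20) one_pos (by norm_num),
    eventually_pow_mul_pow_div_three_le (q := 1 - 3 * η / 4) (by linarith) (by linarith) hx0]
    with n hn hnη hnx hr hrw hrη hlog hlogr hq ℓ hℓ
  have hn0 : (0 : ℝ) < n := Nat.cast_pos.2 (by omega)
  rw [div_le_iff₀ (by positivity)] at hnη hnx hrη
  refine le_trans (by linarith) (one_sub_le_liftProb_of_estimates (x := x) hη0 hη1 ?_ hn
    (by linarith) (min_le_right _ _) (by linarith) hr ?_ (by linarith) (by linarith) ?_ hq)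
  · calc (n : ℝ) ≤ (1 - η) * ((1 + ε) * n) := by
          rw [← mul_assoc]
          exact le_mul_of_one_le_left hn0.le (by nlinarith)
      _ ≤ (1 - η) * ℓ := mul_le_mul_of_nonneg_left hℓ (by linarith)
  · rw [← Real.rpow_natCast, ← Real.rpow_mul hn0.le]
    norm_num
  · intro w hw
    linarith [hw₀ w (hrw.trans hw)]
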